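/- arXiv:1701.02289 — 4 statements merged into one kernel-verified Lean document; each statement's English description precedes it below -/
import Mathlib

section
/- There exist constants c, C > 0 such that for all (η,t) ∈ Γ (i.e. η ∈ ℝ, t > 0, |η| < t), all θ, φ ∈ (0,π) with θ+η ∈ (0,π), and all u, v ∈ [−1,1], one has c·(t² + q(θ,φ,u,v)) ≤ t² + q(θ+η,φ,u,v) ≤ C·(t² + q(θ,φ,u,v)). -/
open Real Set

/-- `q(θ,φ,u,v) = 1 − u sin(θ/2) sin(φ/2) − v cos(θ/2) cos(φ/2)`. -/
noncomputable def q (θ φ u v : ℝ) : ℝ :=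
  1 - u * Real.sin (θ / 2) * Real.sin (φ / 2) - v * Real.cos (θ / 2) * Real.cos (φ / 2)

/-- Moving the first angle by `η` at most doubles `q`, up to an error `η ^ 2 / 4`. -/
theorem q_add_le (θ η φ : ℝ) {u v : ℝ} (hu : u ∈ Icc (-1 : ℝ) 1) (hv : v ∈ Icc (-1 : ℝ) 1) :
    q (θ + η) φ u v ≤ η ^ 2 / 4 + 2 * q θ φ u v := by
  have hcos : cos (η / 2) =
      cos ((θ + η) / 2) * cos (θ / 2) + sin ((θ + η) / 2) * sin (θ / 2) := by
    rw [← cos_sub]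
    ring_nf
  have hη : 1 - (η / 2) ^ 2 / 2 ≤ cos (η / 2) := one_sub_sq_div_two_le_cos
  have hu2 : u ^ 2 ≤ 1 := by nlinarith [hu.1, hu.2]
  have hv2 : v ^ 2 ≤ 1 := by nlinarith [hv.1, hv.2]
  have hab : (u * sin (φ / 2)) ^ 2 + (v * cos (φ / 2)) ^ 2 ≤ 1 := by
    nlinarith [sin_sq_add_cos_sq (φ / 2), mul_nonneg (sub_nonneg.2 hu2) (sq_nonneg (sin (φ / 2))),
      mul_nonneg (sub_nonneg.2 hv2) (sq_nonneg (cos (φ / 2)))]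
  have h₁ := sin_sq_add_cos_sq (θ / 2)
  have h₂ := sin_sq_add_cos_sq ((θ + η) / 2)
  unfold q
  -- The parallelogram inequality for the points at angles `θ / 2`, `(θ + η) / 2` of the unit
  -- circle and the point `(u sin (φ / 2), v cos (φ / 2))` of the unit disc.
  nlinarith [sq_nonneg (sin ((θ + η) / 2) - 2 * sin (θ / 2) + u * sin (φ / 2)),
    sq_nonneg (cos ((θ + η) / 2) - 2 * cos (θ / 2) + v * cos (φ / 2))]

theorem stmt_0 :
    ∃ c C : ℝ, 0 < c ∧ 0 < C ∧
      ∀ η t θ φ u v : ℝ, |η| < t → θ ∈ Ioo 0 π → φ ∈ Ioo 0 π → θ + η ∈ Ioo 0 π →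
        u ∈ Icc (-1 : ℝ) 1 → v ∈ Icc (-1 : ℝ) 1 →
          c * (t ^ 2 + q θ φ u v) ≤ t ^ 2 + q (θ + η) φ u v ∧
          t ^ 2 + q (θ + η) φ u v ≤ C * (t ^ 2 + q θ φ u v) := by
  refine ⟨1 / 2, 2, by norm_num, by norm_num, ?_⟩
  intro η t θ φ u v hη _ _ _ hu hv
  have ht : η ^ 2 ≤ t ^ 2 := sq_le_sq' (abs_lt.1 hη).1.le (abs_lt.1 hη).2.le
  have h₁ := q_add_le θ η φ hu hv
  have h₂ := q_add_le (θ + η) (-η) φ hu hv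
  rw [add_neg_cancel_right, neg_sq] at h₂
  constructor <;> nlinarith [sq_nonneg t]
end

section
/- Let α, β > −1 and let γ ∈ (0,1/2] satisfy γ < min(α,β)+1. Then there exists a constant C > 0 such that for all t > 0 and all θ, θ' ∈ (0,π): ∫_{|η|<t} 1_{{θ+η ∈ (0,π) and θ'+η ∈ (0,π)}} | √(Ω_t^{α,β}(θ,η)) − √(Ω_t^{α,β}(θ',η)) |² dη ≤ C (|θ−θ'|/t)^{2γ} when t ∈ (0,π], and ≤ C |θ−θ'|^{2γ} when t ≥ π. -/
open Real Set MeasureTheory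

/-- The Jacobi measure `μ_{α,β}` on `(0,π)` with density
`(sin(θ/2))^{2α+1} (cos(θ/2))^{2β+1}`. -/
noncomputable def jacobiMeasure (α β : ℝ) : Measure ℝ :=
  (volume.restrict (Ioo 0 π)).withDensity
    (fun θ => ENNReal.ofReal ((Real.sin (θ / 2)) ^ (2 * α + 1) * (Real.cos (θ / 2)) ^ (2 * β + 1)))

/-- The ball `B(θ,r) = (θ−r, θ+r) ∩ (0,π)`. -/
def jacobiBall (θ r : ℝ) : Set ℝ := Ioo (θ - r) (θ + r) ∩ Ioo 0 π

/-- `V_t^{α,β}(θ) = μ_{α,β}(B(θ,t))`. -/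
noncomputable def V (α β t θ : ℝ) : ℝ := (jacobiMeasure α β (jacobiBall θ t)).toReal

/-- `Ω_t^{α,β}(θ,η)`. -/
noncomputable def Omg (α β t θ η : ℝ) : ℝ :=
  (Real.sin ((θ + η) / 2)) ^ (2 * α + 1) * (Real.cos ((θ + η) / 2)) ^ (2 * β + 1) / V α β t θ

/-- The density of `jacobiMeasure`, extended by zero outside `(0,π)`. -/
noncomputable def jacobiWeight (a b x : ℝ) : ℝ :=
  (Ioo 0 π).indicator
    (fun x => Real.sin (x / 2) ^ (2 * a + 1) * Real.cos (x / 2) ^ (2 * b + 1)) x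

theorem sin_half_pos {x : ℝ} (hx : x ∈ Ioo 0 π) : 0 < Real.sin (x / 2) :=
  Real.sin_pos_of_pos_of_lt_pi (by linarith [hx.1]) (by linarith [hx.1, hx.2])

theorem cos_half_pos {x : ℝ} (hx : x ∈ Ioo 0 π) : 0 < Real.cos (x / 2) :=
  Real.cos_pos_of_mem_Ioo ⟨by linarith [hx.1, Real.pi_pos], by linarith [hx.2]⟩

theorem sin_half_mul_cos_half (x : ℝ) :
    Real.sin (x / 2) * Real.cos (x / 2) = Real.sin x / 2 := by
  have := Real.sin_two_mul (x / 2)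
  rw [mul_div_cancel₀ x two_ne_zero] at this
  linarith

theorem jacobiWeight_of_mem (a b : ℝ) {x : ℝ} (hx : x ∈ Ioo 0 π) :
    jacobiWeight a b x = Real.sin (x / 2) ^ (2 * a + 1) * Real.cos (x / 2) ^ (2 * b + 1) :=
  indicator_of_mem hx _

theorem jacobiWeight_of_notMem (a b : ℝ) {x : ℝ} (hx : x ∉ Ioo 0 π) : jacobiWeight a b x = 0 :=
  indicator_of_notMem hx _

theorem jacobiWeight_pos (a b : ℝ) {x : ℝ} (hx : x ∈ Ioo 0 π) : 0 < jacobiWeight a b x := by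
  rw [jacobiWeight_of_mem a b hx]
  exact mul_pos (Real.rpow_pos_of_pos (sin_half_pos hx) _)
    (Real.rpow_pos_of_pos (cos_half_pos hx) _)

theorem jacobiWeight_nonneg (a b x : ℝ) : 0 ≤ jacobiWeight a b x := by
  by_cases hx : x ∈ Ioo 0 π
  · exact (jacobiWeight_pos a b hx).le
  · exact (jacobiWeight_of_notMem a b hx).ge

theorem measurable_jacobiWeight (a b : ℝ) : Measurable (jacobiWeight a b) := by
  unfold jacobiWeight
  exact Measurable.indicator (by fun_prop) measurableSet_Ioo

theorem jacobiWeight_pi_sub (a b x : ℝ) : jacobiWeight a b (π - x) = jacobiWeight b a x := by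
  by_cases hx : x ∈ Ioo 0 π
  · have hx' : π - x ∈ Ioo 0 π := ⟨by linarith [hx.2], by linarith [hx.1]⟩
    rw [jacobiWeight_of_mem a b hx', jacobiWeight_of_mem b a hx, sub_div, Real.sin_pi_div_two_sub,
      Real.cos_pi_div_two_sub, mul_comm]
  · have hx' : π - x ∉ Ioo 0 π := fun h => hx ⟨by linarith [h.2], by linarith [h.1]⟩
    rw [jacobiWeight_of_notMem a b hx', jacobiWeight_of_notMem b a hx]

/-- Lowering both parameters by `γ` divides the weight by `(sin (x/2) cos (x/2))^{2γ}`. -/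
theorem jacobiWeight_sub_sub (a b γ : ℝ) {x : ℝ} (hx : x ∈ Ioo 0 π) :
    jacobiWeight (a - γ) (b - γ) x =
      jacobiWeight a b x / (Real.sin x / 2) ^ (2 * γ) := by
  have hs := sin_half_pos hx
  have hc := cos_half_pos hx
  rw [jacobiWeight_of_mem _ _ hx, jacobiWeight_of_mem _ _ hx, ← sin_half_mul_cos_half,
    Real.mul_rpow hs.le hc.le, mul_div_mul_comm, ← Real.rpow_sub hs, ← Real.rpow_sub hc]
  ring_nf

theorem abs_log_sub_log_le {A B h : ℝ} (hA : 0 < A) (hAB : |A - B| ≤ h / 2) (hh : h ≤ A) :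
    |Real.log A - Real.log B| ≤ h / A := by
  obtain ⟨h1, h2⟩ := abs_le.1 hAB
  have hB : A / 2 ≤ B := by linarith
  have hB0 : 0 < B := by linarith
  have h3 := Real.log_le_sub_one_of_pos (div_pos hA hB0)
  have h4 := Real.log_le_sub_one_of_pos (div_pos hB0 hA)
  rw [Real.log_div hA.ne' hB0.ne'] at h3
  rw [Real.log_div hB0.ne' hA.ne'] at h4
  have h0 : 0 ≤ h := by linarith [abs_nonneg (A - B)]
  have h5 : A / B - 1 ≤ h / A := by
    rw [div_sub_one hB0.ne', div_le_div_iff₀ hB0 hA]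
    nlinarith
  have h6 : B / A - 1 ≤ h / A := by
    rw [div_sub_one hA.ne']
    gcongr
    linarith
  rw [abs_le]
  constructor <;> linarith

theorem abs_sin_half_sub_le (x y : ℝ) : |Real.sin (x / 2) - Real.sin (y / 2)| ≤ |x - y| / 2 := by
  simpa [← sub_div, abs_div] using Real.abs_sin_sub_sin_le (x / 2) (y / 2)

theorem abs_cos_half_sub_le (x y : ℝ) : |Real.cos (x / 2) - Real.cos (y / 2)| ≤ |x - y| / 2 := by
  simpa [← sub_div, abs_div] using Real.abs_cos_sub_cos_le (x / 2) (y / 2)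

theorem log_jacobiWeight (a b : ℝ) {x : ℝ} (hx : x ∈ Ioo 0 π) :
    Real.log (jacobiWeight a b x) =
      (2 * a + 1) * Real.log (Real.sin (x / 2)) + (2 * b + 1) * Real.log (Real.cos (x / 2)) := by
  have hs := sin_half_pos hx
  have hc := cos_half_pos hx
  rw [jacobiWeight_of_mem _ _ hx, Real.log_mul (Real.rpow_pos_of_pos hs _).ne'
    (Real.rpow_pos_of_pos hc _).ne', Real.log_rpow hs, Real.log_rpow hc]

theorem sqrt_jacobiWeight_sub_le {a b γ x y : ℝ} (hγ₀ : 0 < γ) (hγ₁ : γ ≤ 1)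
    (hx : x ∈ Ioo 0 π) :
    √(jacobiWeight a b x) - √(jacobiWeight a b y) ≤
      (1 + |2 * a + 1| + |2 * b + 1|) * (|x - y| / (Real.sin x / 2)) ^ γ *
        √(jacobiWeight a b x) := by
  have hs := sin_half_pos hx
  have hc := cos_half_pos hx
  have hsin : 0 < Real.sin x / 2 := half_pos (Real.sin_pos_of_mem_Ioo hx)
  have hprod := sin_half_mul_cos_half x
  have ha := abs_nonneg (2 * a + 1)
  have hb := abs_nonneg (2 * b + 1)
  have hh := abs_nonneg (x - y)
  have hWx := Real.sqrt_pos.2 (jacobiWeight_pos a b hx)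
  have hWy := Real.sqrt_nonneg (jacobiWeight a b y)
  rcases le_total (Real.sin x / 2) |x - y| with hle | hle
  · have h1 : 1 ≤ (|x - y| / (Real.sin x / 2)) ^ γ :=
      Real.one_le_rpow ((one_le_div hsin).2 hle) hγ₀.le
    have h2 : 1 ≤ (1 + |2 * a + 1| + |2 * b + 1|) * (|x - y| / (Real.sin x / 2)) ^ γ :=
      one_le_mul_of_one_le_of_one_le (by linarith) h1
    nlinarith
  · have hsx : Real.sin x ≤ x := Real.sin_le hx.1.le
    have hsx' : Real.sin x ≤ π - x := by
      rw [← Real.sin_pi_sub]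
      exact Real.sin_le (by linarith [hx.2])
    have hy : y ∈ Ioo 0 π := by
      obtain ⟨h1, h2⟩ := abs_le.1 hle
      constructor <;> linarith
    have hAs : Real.sin x / 2 ≤ Real.sin (x / 2) := by
      rw [← hprod]
      exact mul_le_of_le_one_right hs.le (Real.cos_le_one _)
    have hAc : Real.sin x / 2 ≤ Real.cos (x / 2) := by
      rw [← hprod]
      exact mul_le_of_le_one_left hc.le (Real.sin_le_one _)
    have hls : |Real.log (Real.sin (x / 2)) - Real.log (Real.sin (y / 2))| ≤
        |x - y| / (Real.sin x / 2) :=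
      (abs_log_sub_log_le hs (abs_sin_half_sub_le x y) (hle.trans hAs)).trans (by gcongr)
    have hlc : |Real.log (Real.cos (x / 2)) - Real.log (Real.cos (y / 2))| ≤
        |x - y| / (Real.sin x / 2) :=
      (abs_log_sub_log_le hc (abs_cos_half_sub_le x y) (hle.trans hAc)).trans (by gcongr)
    set d := |x - y| / (Real.sin x / 2) with hd
    have hd0 : 0 ≤ d := by positivity
    have hd1 : d ≤ 1 := (div_le_one hsin).2 hle
    have hdγ : d ≤ d ^ γ := by
      simpa using Real.rpow_le_rpow_of_exponent_ge' hd0 hd1 hγ₀.le hγ₁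
    have hWy := Real.sqrt_pos.2 (jacobiWeight_pos a b hy)
    have hlog := Real.log_le_sub_one_of_pos (div_pos hWy hWx)
    rw [Real.log_div hWy.ne' hWx.ne', Real.log_sqrt (jacobiWeight_nonneg _ _ _),
      Real.log_sqrt (jacobiWeight_nonneg _ _ _), log_jacobiWeight a b hx,
      log_jacobiWeight a b hy] at hlog
    have e1 : (2 * a + 1) * (Real.log (Real.sin (x / 2)) - Real.log (Real.sin (y / 2))) ≤
        |2 * a + 1| * d :=
      (le_abs_self _).trans ((abs_mul _ _).trans_le (by gcongr))
    have e2 : (2 * b + 1) * (Real.log (Real.cos (x / 2)) - Real.log (Real.cos (y / 2))) ≤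
        |2 * b + 1| * d :=
      (le_abs_self _).trans ((abs_mul _ _).trans_le (by gcongr))
    have e3 : 1 - √(jacobiWeight a b y) / √(jacobiWeight a b x) ≤
        (1 + |2 * a + 1| + |2 * b + 1|) * d := by
      have := mul_nonneg ha hd0
      have := mul_nonneg hb hd0
      linarith
    calc √(jacobiWeight a b x) - √(jacobiWeight a b y)
        = (1 - √(jacobiWeight a b y) / √(jacobiWeight a b x)) * √(jacobiWeight a b x) := by
          field_simp
      _ ≤ (1 + |2 * a + 1| + |2 * b + 1|) * d ^ γ * √(jacobiWeight a b x) := by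
          gcongr
          exact e3.trans (by gcongr)

theorem sq_sqrt_jacobiWeight_sub_le {a b γ : ℝ} (hγ₀ : 0 < γ) (hγ₁ : γ ≤ 1) (x y : ℝ) :
    (√(jacobiWeight a b x) - √(jacobiWeight a b y)) ^ 2 ≤
      (1 + |2 * a + 1| + |2 * b + 1|) ^ 2 * |x - y| ^ (2 * γ) *
        (jacobiWeight (a - γ) (b - γ) x + jacobiWeight (a - γ) (b - γ) y) := by
  wlog hle : jacobiWeight a b y ≤ jacobiWeight a b x generalizing x y
  · have := this y x (le_of_not_ge hle)
    rw [abs_sub_comm, add_comm (jacobiWeight (a - γ) (b - γ) x)]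
    linarith [sub_sq_comm √(jacobiWeight a b x) √(jacobiWeight a b y)]
  have hy0 := jacobiWeight_nonneg (a - γ) (b - γ) y
  by_cases hx : x ∈ Ioo 0 π
  · have hsin : 0 < Real.sin x / 2 := half_pos (Real.sin_pos_of_mem_Ioo hx)
    have h1 := sqrt_jacobiWeight_sub_le (a := a) (b := b) (y := y) hγ₀ hγ₁ hx
    have h0 : 0 ≤ √(jacobiWeight a b x) - √(jacobiWeight a b y) :=
      sub_nonneg.2 (Real.sqrt_le_sqrt hle)
    calc (√(jacobiWeight a b x) - √(jacobiWeight a b y)) ^ 2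
        ≤ ((1 + |2 * a + 1| + |2 * b + 1|) * (|x - y| / (Real.sin x / 2)) ^ γ *
            √(jacobiWeight a b x)) ^ 2 := by gcongr
      _ = (1 + |2 * a + 1| + |2 * b + 1|) ^ 2 * |x - y| ^ (2 * γ) *
            jacobiWeight (a - γ) (b - γ) x := by
          rw [mul_pow, mul_pow, Real.sq_sqrt (jacobiWeight_nonneg _ _ _), ← Real.rpow_mul_natCast
            (by positivity), jacobiWeight_sub_sub a b γ hx, Nat.cast_two, mul_comm γ 2,
            Real.div_rpow (abs_nonneg _) hsin.le]
          ring
      _ ≤ _ := by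
          gcongr
          linarith
  · have hx0 := jacobiWeight_of_notMem a b hx
    have hy0 : jacobiWeight a b y = 0 :=
      le_antisymm (hx0 ▸ hle) (jacobiWeight_nonneg _ _ _)
    rw [hx0, hy0, sub_self, zero_pow two_ne_zero]
    have := jacobiWeight_nonneg (a - γ) (b - γ) x
    positivity

theorem min_rpow_le_rpow {m M y : ℝ} (p : ℝ) (hm : 0 < m) (hy : y ∈ Icc m M) :
    min (m ^ p) (M ^ p) ≤ y ^ p := by
  rcases le_total 0 p with hp | hp
  · exact (min_le_left _ _).trans (Real.rpow_le_rpow hm.le hy.1 hp)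
  · exact (min_le_right _ _).trans (Real.rpow_le_rpow_of_nonpos (hm.trans_le hy.1) hy.2 hp)

theorem rpow_le_max_rpow {m M y : ℝ} (p : ℝ) (hm : 0 < m) (hy : y ∈ Icc m M) :
    y ^ p ≤ max (m ^ p) (M ^ p) := by
  rcases le_total 0 p with hp | hp
  · exact (Real.rpow_le_rpow (hm.trans_le hy.1).le hy.2 hp).trans (le_max_right _ _)
  · exact (Real.rpow_le_rpow_of_nonpos hm hy.1 hp).trans (le_max_left _ _)

theorem exists_rpow_le_jacobiWeight_le_rpow (a b : ℝ) :
    ∃ c > 0, ∃ C > 0, ∀ x ∈ Ioc 0 (π / 2),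
      c * x ^ (2 * a + 1) ≤ jacobiWeight a b x ∧ jacobiWeight a b x ≤ C * x ^ (2 * a + 1) := by
  have hπ := Real.pi_pos
  refine ⟨min (π⁻¹ ^ (2 * a + 1)) (1 ^ (2 * a + 1)) *
      min ((1 / 2) ^ (2 * b + 1)) (1 ^ (2 * b + 1)), by positivity,
    max (π⁻¹ ^ (2 * a + 1)) (1 ^ (2 * a + 1)) *
      max ((1 / 2) ^ (2 * b + 1)) (1 ^ (2 * b + 1)), by positivity, fun x hx => ?_⟩
  have hx' : x ∈ Ioo 0 π := ⟨hx.1, by linarith [hx.2]⟩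
  have hx0 := hx.1
  have hs : Real.sin (x / 2) / x ∈ Icc π⁻¹ 1 := by
    constructor
    · rw [le_div_iff₀ hx0]
      calc π⁻¹ * x = 2 / π * (x / 2) := by field_simp
        _ ≤ _ := Real.mul_le_sin (by linarith) (by linarith [hx.2])
    · rw [div_le_one hx0]
      linarith [Real.sin_le (x := x / 2) (by linarith)]
  have hc : Real.cos (x / 2) ∈ Icc (1 / 2) 1 := by
    refine ⟨?_, Real.cos_le_one _⟩
    refine le_trans ?_ (Real.one_sub_mul_le_cos (x := x / 2) (by linarith) (by linarith [hx.2]))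
    have : 2 / π * (x / 2) ≤ 2 / π * (π / 4) :=
      mul_le_mul_of_nonneg_left (by linarith [hx.2]) (by positivity)
    have h2 : 2 / π * (π / 4) = 1 / 2 := by field_simp; norm_num
    linarith
  have hW : jacobiWeight a b x = (Real.sin (x / 2) / x) ^ (2 * a + 1) *
      Real.cos (x / 2) ^ (2 * b + 1) * x ^ (2 * a + 1) := by
    rw [jacobiWeight_of_mem a b hx', Real.div_rpow (sin_half_pos hx').le hx0.le]
    have := (Real.rpow_pos_of_pos hx0 (2 * a + 1)).ne'
    field_simp
  have hs0 : 0 ≤ (Real.sin (x / 2) / x) ^ (2 * a + 1) :=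
    Real.rpow_nonneg (div_nonneg (sin_half_pos hx').le hx0.le) _
  rw [hW]
  constructor
  · gcongr
    · exact min_rpow_le_rpow _ (by positivity) hs
    · exact min_rpow_le_rpow _ (by norm_num) hc
  · gcongr
    · exact Real.rpow_nonneg (by linarith [hc.1]) _
    · exact rpow_le_max_rpow _ (by positivity) hs
    · exact rpow_le_max_rpow _ (by norm_num) hc

theorem integrable_jacobiWeight {a b : ℝ} (ha : -1 < a) (hb : -1 < b) :
    Integrable (jacobiWeight a b) := by
  have half : ∀ {a : ℝ} (b : ℝ), -1 < a →
      Integrable ((Ioc 0 (π / 2)).indicator (jacobiWeight a b)) := by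
    intro a b ha
    obtain ⟨c, hc, C, hC, h⟩ := exists_rpow_le_jacobiWeight_le_rpow a b
    rw [integrable_indicator_iff measurableSet_Ioc]
    have hI : IntegrableOn (fun x : ℝ => C * x ^ (2 * a + 1)) (Ioc 0 (π / 2)) :=
      (((intervalIntegral.integrableOn_Ioo_rpow_iff two_pos).2 (by linarith)).mono_set
        fun x hx => ⟨hx.1, by linarith [hx.2, Real.pi_lt_four]⟩).const_mul C
    refine Integrable.mono' hI (measurable_jacobiWeight a b).aestronglyMeasurable ?_
    filter_upwards [ae_restrict_mem measurableSet_Ioc] with x hx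
    rw [Real.norm_of_nonneg (jacobiWeight_nonneg _ _ _)]
    exact (h x hx).2
  refine Integrable.mono' ((half b ha).add ((half a hb).comp_sub_left π))
    (measurable_jacobiWeight a b).aestronglyMeasurable (Filter.Eventually.of_forall fun x => ?_)
  have h0 : ∀ a b x, 0 ≤ (Ioc 0 (π / 2)).indicator (jacobiWeight a b) x := fun a b x =>
    indicator_nonneg (fun x _ => jacobiWeight_nonneg a b x) x
  rw [Real.norm_of_nonneg (jacobiWeight_nonneg _ _ _), Pi.add_apply]
  by_cases hx : x ∈ Ioo 0 π
  · rcases le_total x (π / 2) with h | h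
    · rw [indicator_of_mem (show x ∈ Ioc 0 (π / 2) from ⟨hx.1, h⟩)]
      linarith [h0 b a (π - x)]
    · rw [indicator_of_mem (show π - x ∈ Ioc 0 (π / 2) from ⟨by linarith [hx.2], by linarith⟩),
        jacobiWeight_pi_sub]
      linarith [h0 a b x]
  · rw [jacobiWeight_of_notMem a b hx]
    exact add_nonneg (h0 _ _ _) (h0 _ _ _)

theorem V_eq_setIntegral (a b t θ : ℝ) :
    V a b t θ = ∫ x in Ioo (θ - t) (θ + t), jacobiWeight a b x := by
  have hm : MeasurableSet (jacobiBall θ t) := measurableSet_Ioo.inter measurableSet_Ioo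
  simp only [jacobiWeight]
  rw [V, jacobiMeasure, withDensity_apply _ hm, Measure.restrict_restrict hm,
    setIntegral_indicator measurableSet_Ioo, jacobiBall, inter_assoc, inter_self,
    integral_eq_lintegral_of_nonneg_ae]
  · filter_upwards [ae_restrict_mem (measurableSet_Ioo.inter measurableSet_Ioo)] with x hx
    rw [← jacobiWeight_of_mem a b hx.2]
    exact jacobiWeight_nonneg a b x
  · exact Measurable.aestronglyMeasurable (by fun_prop)

theorem V_nonneg (a b t θ : ℝ) : 0 ≤ V a b t θ := ENNReal.toReal_nonneg

theorem V_pos {a b t θ : ℝ} (ha : -1 < a) (hb : -1 < b) (ht : 0 < t) (hθ : θ ∈ Ioo 0 π) :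
    0 < V a b t θ := by
  rw [V_eq_setIntegral, setIntegral_pos_iff_support_of_nonneg_ae
    (Filter.Eventually.of_forall (jacobiWeight_nonneg a b))
    (integrable_jacobiWeight ha hb).integrableOn]
  have hsub : Ioo (max (θ - t) 0) (min (θ + t) π) ⊆
      Function.support (jacobiWeight a b) ∩ Ioo (θ - t) (θ + t) := by
    intro x hx
    obtain ⟨h1, h2⟩ := max_lt_iff.1 hx.1
    obtain ⟨h3, h4⟩ := lt_min_iff.1 hx.2
    exact ⟨(jacobiWeight_pos a b ⟨h2, h4⟩).ne', h1, h3⟩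
  refine lt_of_lt_of_le ?_ (measure_mono hsub)
  rw [Real.volume_Ioo, ENNReal.ofReal_pos, sub_pos]
  exact max_lt (lt_min (by linarith) (by linarith [hθ.2]))
    (lt_min (by linarith [hθ.1]) Real.pi_pos)

theorem setIntegral_Ioo_comp_add_left (f : ℝ → ℝ) {t : ℝ} (ht : 0 ≤ t) (θ : ℝ) :
    ∫ η in Ioo (-t) t, f (θ + η) = ∫ x in Ioo (θ - t) (θ + t), f x := by
  rw [← integral_Ioc_eq_integral_Ioo, ← integral_Ioc_eq_integral_Ioo,
    ← intervalIntegral.integral_of_le (by linarith), ← intervalIntegral.integral_of_le (by linarith),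
    intervalIntegral.integral_comp_add_left, sub_eq_add_neg]

theorem setIntegral_Ioo_comp_sub_left (f : ℝ → ℝ) {t : ℝ} (ht : 0 ≤ t) (c θ : ℝ) :
    ∫ x in Ioo (θ - t) (θ + t), f (c - x) = ∫ x in Ioo (c - θ - t) (c - θ + t), f x := by
  rw [← integral_Ioc_eq_integral_Ioo, ← integral_Ioc_eq_integral_Ioo,
    ← intervalIntegral.integral_of_le (by linarith), ← intervalIntegral.integral_of_le (by linarith),
    intervalIntegral.integral_comp_sub_left, sub_add, sub_sub]

theorem V_pi_sub (a b θ : ℝ) {t : ℝ} (ht : 0 ≤ t) : V a b t (π - θ) = V b a t θ := by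
  rw [V_eq_setIntegral, V_eq_setIntegral, ← setIntegral_Ioo_comp_sub_left _ ht]
  simp only [jacobiWeight_pi_sub]

theorem setIntegral_Ioo_rpow {u v p : ℝ} (huv : u ≤ v) (hp : -1 < p) :
    ∫ x in Ioo u v, x ^ p = (v ^ (p + 1) - u ^ (p + 1)) / (p + 1) := by
  rw [← integral_Ioc_eq_integral_Ioo, ← intervalIntegral.integral_of_le huv,
    integral_rpow (Or.inl hp)]

theorem integrableOn_Ioo_rpow {u v p : ℝ} (huv : u ≤ v) (hp : -1 < p) :
    IntegrableOn (fun x : ℝ => x ^ p) (Ioo u v) :=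
  ((intervalIntegrable_iff_integrableOn_Ioc_of_le huv).1
    (intervalIntegral.intervalIntegrable_rpow' hp)).mono_set Ioo_subset_Ioc_self

theorem exists_setIntegral_jacobiWeight_le {a γ : ℝ} (b : ℝ) (ha : γ < a + 1) (hγ : 0 < γ)
    (hb : γ < b + 1) :
    ∃ C > 0, ∀ t ∈ Ioc 0 π, ∀ θ ∈ Ioo 0 π,
      ∫ x in Ioo (θ - t) (θ + t), (Ioo 0 (t / 4)).indicator (jacobiWeight (a - γ) (b - γ)) x ≤
        C / t ^ (2 * γ) * V a b t θ := by
  obtain ⟨_, _, C, hC, hup⟩ := exists_rpow_le_jacobiWeight_le_rpow (a - γ) (b - γ)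
  obtain ⟨c, hc, _, _, hlow⟩ := exists_rpow_le_jacobiWeight_le_rpow a b
  set p := 2 * a + 1 with hp
  set q := 2 * (a - γ) + 1 with hq
  have hp1 : 0 < p + 1 := by linarith
  have hq1 : 0 < q + 1 := by linarith
  set D := ((1 / 2 : ℝ) ^ (p + 1) - (1 / 4) ^ (p + 1)) / (p + 1) with hD
  have hD0 : 0 < D :=
    div_pos (sub_pos.2 (Real.rpow_lt_rpow (by norm_num) (by norm_num) hp1)) hp1
  set E := (1 / 4 : ℝ) ^ (q + 1) / (q + 1) with hE
  have hE0 : 0 < E := by positivity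
  refine ⟨C * E / (c * D), by positivity, fun t ht θ hθ => ?_⟩
  have ht0 := ht.1
  have htp := Real.rpow_pos_of_pos ht0 (2 * γ)
  rcases le_or_gt (t / 4) (θ - t) with h | h
  · rw [setIntegral_eq_zero_of_forall_eq_zero]
    · exact mul_nonneg (by positivity) (V_nonneg _ _ _ _)
    · intro x hx
      exact indicator_of_notMem (fun h' => by linarith [hx.1, h'.2]) _
  · have hupper : ∫ x in Ioo (θ - t) (θ + t),
        (Ioo 0 (t / 4)).indicator (jacobiWeight (a - γ) (b - γ)) x ≤ C * (t ^ (q + 1) * E) := by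
      have hWint := integrable_jacobiWeight (a := a - γ) (b := b - γ) (by linarith) (by linarith)
      rw [setIntegral_indicator measurableSet_Ioo]
      calc _ ≤ ∫ x in Ioo 0 (t / 4), jacobiWeight (a - γ) (b - γ) x :=
            setIntegral_mono_set hWint.integrableOn
              (Filter.Eventually.of_forall (jacobiWeight_nonneg _ _))
              (LE.le.eventuallyLE inter_subset_right)
        _ ≤ ∫ x in Ioo 0 (t / 4), C * x ^ q :=
            setIntegral_mono_on hWint.integrableOn
              ((integrableOn_Ioo_rpow (by linarith) (by linarith)).const_mul C) measurableSet_Ioo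
              fun x hx => (hup x ⟨hx.1, by linarith [hx.2, ht.2, Real.pi_pos]⟩).2
        _ = C * (t ^ (q + 1) * E) := by
            rw [integral_const_mul, setIntegral_Ioo_rpow (by linarith) (by linarith),
              Real.zero_rpow hq1.ne', sub_zero, hE, div_eq_mul_one_div t 4,
              Real.mul_rpow ht0.le (by norm_num), mul_div_assoc]
    have hlower : c * (t ^ (p + 1) * D) ≤ V a b t θ := by
      have hWint := integrable_jacobiWeight (a := a) (b := b) (by linarith) (by linarith)
      rw [V_eq_setIntegral]
      calc c * (t ^ (p + 1) * D) = ∫ x in Ioo (t / 4) (t / 2), c * x ^ p := by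
            rw [integral_const_mul, setIntegral_Ioo_rpow (by linarith) (by linarith), hD,
              div_eq_mul_one_div t 4, div_eq_mul_one_div t 2,
              Real.mul_rpow ht0.le (by norm_num), Real.mul_rpow ht0.le (by norm_num), ← mul_sub,
              mul_div_assoc]
        _ ≤ ∫ x in Ioo (t / 4) (t / 2), jacobiWeight a b x :=
            setIntegral_mono_on
              ((integrableOn_Ioo_rpow (by linarith) (by linarith)).const_mul c)
              hWint.integrableOn measurableSet_Ioo
              fun x hx => (hlow x ⟨by linarith [hx.1], by linarith [hx.2, ht.2]⟩).1
        _ ≤ _ :=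
            setIntegral_mono_set hWint.integrableOn
              (Filter.Eventually.of_forall (jacobiWeight_nonneg _ _))
              (LE.le.eventuallyLE
                (Ioo_subset_Ioo h.le (by linarith [hθ.1])))
    have hpq : t ^ (q + 1) = t ^ (p + 1) / t ^ (2 * γ) := by
      rw [← Real.rpow_sub ht0]
      congr 1
      ring
    calc _ ≤ C * (t ^ (q + 1) * E) := hupper
      _ = C * E / (c * D) / t ^ (2 * γ) * (c * (t ^ (p + 1) * D)) := by
          rw [hpq]
          field_simp
      _ ≤ _ := by gcongr

/-- On a ball of radius `t`, dividing the weight by `(sin (x/2) cos (x/2))^{2γ}` costs at most a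
factor comparable to `t^{-2γ}`. -/
theorem exists_V_sub_sub_le {a b γ : ℝ} (ha : γ < a + 1) (hb : γ < b + 1) (hγ : 0 < γ) :
    ∃ C > 0, ∀ t ∈ Ioc 0 π, ∀ θ ∈ Ioo 0 π,
      V (a - γ) (b - γ) t θ ≤ C / t ^ (2 * γ) * V a b t θ := by
  obtain ⟨C₁, hC₁, h₁⟩ := exists_setIntegral_jacobiWeight_le b ha hγ hb
  obtain ⟨C₂, hC₂, h₂⟩ := exists_setIntegral_jacobiWeight_le a hb hγ ha
  have hπ := Real.pi_pos
  refine ⟨(4 * π) ^ (2 * γ) + C₁ + C₂, by positivity, fun t ht θ hθ => ?_⟩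
  have ht0 := ht.1
  have hnn : ∀ a b x, 0 ≤ (Ioo 0 (t / 4)).indicator (jacobiWeight a b) x := fun a b x =>
    indicator_nonneg (fun x _ => jacobiWeight_nonneg a b x) x
  have hpt : ∀ x, jacobiWeight (a - γ) (b - γ) x ≤
      (4 * π) ^ (2 * γ) / t ^ (2 * γ) * jacobiWeight a b x +
        (Ioo 0 (t / 4)).indicator (jacobiWeight (a - γ) (b - γ)) x +
        (Ioo 0 (t / 4)).indicator (jacobiWeight (b - γ) (a - γ)) (π - x) := by
    intro x
    have hW : 0 ≤ (4 * π) ^ (2 * γ) / t ^ (2 * γ) * jacobiWeight a b x :=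
      mul_nonneg (by positivity) (jacobiWeight_nonneg _ _ _)
    have hi₁ := hnn (a - γ) (b - γ) x
    have hi₂ := hnn (b - γ) (a - γ) (π - x)
    by_cases hx : x ∈ Ioo 0 π
    · rcases lt_or_ge x (t / 4) with h | h
      · rw [indicator_of_mem (show x ∈ Ioo 0 (t / 4) from ⟨hx.1, h⟩)]
        linarith
      rcases lt_or_ge (π - x) (t / 4) with h' | h'
      · rw [indicator_of_mem (show π - x ∈ Ioo 0 (t / 4) from ⟨by linarith [hx.2], h'⟩),
          jacobiWeight_pi_sub]
        linarith
      have hsin : t / (4 * π) ≤ Real.sin x / 2 := by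
        have key : ∀ y, t / 4 ≤ y → y ≤ π / 2 → t / (4 * π) ≤ Real.sin y / 2 := by
          intro y hy hy'
          have h1 := Real.mul_le_sin (x := y) (by linarith) hy'
          have h2 : 2 / π * (t / 4) ≤ 2 / π * y := by gcongr
          have h3 : 2 / π * (t / 4) = 2 * (t / (4 * π)) := by field_simp
          linarith
        rcases le_total x (π / 2) with hx2 | hx2
        · exact key x h hx2
        · rw [← Real.sin_pi_sub]
          exact key (π - x) h' (by linarith)
      have hle : jacobiWeight (a - γ) (b - γ) x ≤
          (4 * π) ^ (2 * γ) / t ^ (2 * γ) * jacobiWeight a b x := by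
        rw [jacobiWeight_sub_sub a b γ hx]
        calc _ ≤ jacobiWeight a b x / (t / (4 * π)) ^ (2 * γ) := by
              gcongr
              exact jacobiWeight_nonneg _ _ _
          _ = _ := by
              rw [Real.div_rpow ht0.le (by positivity)]
              field_simp
      linarith
    · rw [jacobiWeight_of_notMem _ _ hx]
      linarith
  have hI := (integrable_jacobiWeight (a := a) (b := b) (by linarith) (by linarith)).const_mul
    ((4 * π) ^ (2 * γ) / t ^ (2 * γ))
  have hI₀ := integrable_jacobiWeight (a := a - γ) (b := b - γ) (by linarith) (by linarith)
  have hI₁ := hI₀.indicator (measurableSet_Ioo (a := 0) (b := t / 4))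
  have hI₂ := ((integrable_jacobiWeight (a := b - γ) (b := a - γ) (by linarith)
    (by linarith)).indicator (measurableSet_Ioo (a := 0) (b := t / 4))).comp_sub_left π
  have hI₀₁ : Integrable fun x => (4 * π) ^ (2 * γ) / t ^ (2 * γ) * jacobiWeight a b x +
      (Ioo 0 (t / 4)).indicator (jacobiWeight (a - γ) (b - γ)) x := hI.add hI₁
  have h₂' := h₂ t ht (π - θ) ⟨by linarith [hθ.2], by linarith [hθ.1]⟩
  rw [V_pi_sub _ _ _ ht0.le, ← setIntegral_Ioo_comp_sub_left _ ht0.le] at h₂'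
  calc V (a - γ) (b - γ) t θ
      ≤ ∫ x in Ioo (θ - t) (θ + t), ((4 * π) ^ (2 * γ) / t ^ (2 * γ) * jacobiWeight a b x +
        (Ioo 0 (t / 4)).indicator (jacobiWeight (a - γ) (b - γ)) x +
        (Ioo 0 (t / 4)).indicator (jacobiWeight (b - γ) (a - γ)) (π - x)) := by
        rw [V_eq_setIntegral]
        exact integral_mono hI₀.integrableOn (hI₀₁.add hI₂).integrableOn hpt
    _ = (4 * π) ^ (2 * γ) / t ^ (2 * γ) * V a b t θ +
        (∫ x in Ioo (θ - t) (θ + t),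
          (Ioo 0 (t / 4)).indicator (jacobiWeight (a - γ) (b - γ)) x) +
        ∫ x in Ioo (θ - t) (θ + t),
          (Ioo 0 (t / 4)).indicator (jacobiWeight (b - γ) (a - γ)) (π - x) := by
        rw [integral_add hI₀₁.integrableOn hI₂.integrableOn,
          integral_add hI.integrableOn hI₁.integrableOn, integral_const_mul, V_eq_setIntegral]
    _ ≤ (4 * π) ^ (2 * γ) / t ^ (2 * γ) * V a b t θ + C₁ / t ^ (2 * γ) * V a b t θ +
        C₂ / t ^ (2 * γ) * V a b t θ := by
        gcongr
        exact h₁ t ht θ hθ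
    _ = _ := by ring

theorem integral_sq_normalized_sub_le {X : Type*} [MeasurableSpace X] {μ : Measure X}
    {f g : X → ℝ} (hf : Integrable (fun x => f x ^ 2) μ) (hg : Integrable (fun x => g x ^ 2) μ)
    (hfg : Integrable (fun x => f x * g x) μ) (hfg₀ : 0 ≤ ∫ x, f x * g x ∂μ)
    (hg₀ : 0 < ∫ x, g x ^ 2 ∂μ) (hle : ∫ x, g x ^ 2 ∂μ ≤ ∫ x, f x ^ 2 ∂μ) :
    ∫ x, (f x / √(∫ x, f x ^ 2 ∂μ) - g x / √(∫ x, g x ^ 2 ∂μ)) ^ 2 ∂μ ≤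
      4 * (∫ x, (f x - g x) ^ 2 ∂μ) / ∫ x, f x ^ 2 ∂μ := by
  have hexp : ∀ r s : ℝ, ∫ x, (r * f x - s * g x) ^ 2 ∂μ =
      r ^ 2 * (∫ x, f x ^ 2 ∂μ) + s ^ 2 * (∫ x, g x ^ 2 ∂μ) -
        2 * r * s * ∫ x, f x * g x ∂μ := by
    intro r s
    have hadd : Integrable (fun x => r ^ 2 * f x ^ 2 + s ^ 2 * g x ^ 2) μ :=
      (hf.const_mul _).add (hg.const_mul _)
    rw [← integral_const_mul, ← integral_const_mul, ← integral_const_mul,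
      ← integral_add (hf.const_mul _) (hg.const_mul _),
      ← integral_sub hadd (hfg.const_mul _)]
    congr 1 with x
    ring
  have h1 := hexp 1 1
  have h2 := hexp (√(∫ x, f x ^ 2 ∂μ))⁻¹ (√(∫ x, g x ^ 2 ∂μ))⁻¹
  have h3 : 0 ≤ ∫ x, ((√(∫ x, f x ^ 2 ∂μ))⁻¹ * f x - (√(∫ x, g x ^ 2 ∂μ))⁻¹ * g x) ^ 2 ∂μ :=
    integral_nonneg fun x => sq_nonneg _
  simp only [one_mul, mul_one, one_pow] at h1
  simp only [div_eq_inv_mul (f _), div_eq_inv_mul (g _)]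
  rw [h1, h2]
  rw [h2] at h3
  set F := ∫ x, f x ^ 2 ∂μ
  set G := ∫ x, g x ^ 2 ∂μ
  set c := ∫ x, f x * g x ∂μ
  have hA : 0 < √F := Real.sqrt_pos.2 (hg₀.trans_le hle)
  have hB : 0 < √G := Real.sqrt_pos.2 hg₀
  have hF : F = √F ^ 2 := (Real.sq_sqrt (hg₀.trans_le hle).le).symm
  have hG : G = √G ^ 2 := (Real.sq_sqrt hg₀.le).symm
  generalize √F = A at *
  generalize √G = B at *
  rw [hF, hG] at h3 ⊢
  obtain ⟨y, hy⟩ : ∃ y, c = y * (A * B) := ⟨c / (A * B), by field_simp⟩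
  have hL : A⁻¹ ^ 2 * A ^ 2 + B⁻¹ ^ 2 * B ^ 2 - 2 * A⁻¹ * B⁻¹ * c = 2 - 2 * y := by
    rw [hy]
    field_simp
    ring
  rw [hL] at h3 ⊢
  rw [hy] at hfg₀ ⊢
  have hy0 : 0 ≤ y := nonneg_of_mul_nonneg_left hfg₀ (by positivity)
  rw [le_div_iff₀ (by positivity)]
  nlinarith [mul_nonneg hy0 (sq_nonneg (A - B)),
    mul_nonneg (show 0 ≤ 1 - y by linarith) (sq_nonneg A),
    mul_nonneg (show 0 ≤ 1 - y by linarith) (sq_nonneg B)]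

theorem sq_abs_sqrt_Omg_sub_le (a b t θ θ' η : ℝ) :
    (if θ + η ∈ Ioo (0 : ℝ) π ∧ θ' + η ∈ Ioo (0 : ℝ) π then
        |√(Omg a b t θ η) - √(Omg a b t θ' η)| ^ 2 else 0) ≤
      (√(jacobiWeight a b (θ + η)) / √(V a b t θ) -
        √(jacobiWeight a b (θ' + η)) / √(V a b t θ')) ^ 2 := by
  split_ifs with h
  · rw [sq_abs, Omg, Omg, ← jacobiWeight_of_mem a b h.1, ← jacobiWeight_of_mem a b h.2,
      Real.sqrt_div (jacobiWeight_nonneg _ _ _), Real.sqrt_div (jacobiWeight_nonneg _ _ _)]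
  · exact sq_nonneg _

theorem exists_integral_sqrt_Omg_sub_le {a b γ : ℝ} (ha : γ < a + 1) (hb : γ < b + 1)
    (hγ₀ : 0 < γ) (hγ₁ : γ ≤ 1) :
    ∃ C > 0, ∀ t ∈ Ioc 0 π, ∀ θ ∈ Ioo 0 π, ∀ θ' ∈ Ioo 0 π,
      (∫ η in Ioo (-t) t,
        (if θ + η ∈ Ioo (0 : ℝ) π ∧ θ' + η ∈ Ioo (0 : ℝ) π then
          |√(Omg a b t θ η) - √(Omg a b t θ' η)| ^ 2 else 0)) ≤
        C * (|θ - θ'| / t) ^ (2 * γ) := by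
  obtain ⟨C, hC, hV⟩ := exists_V_sub_sub_le ha hb hγ₀
  set K := (1 + |2 * a + 1| + |2 * b + 1|) ^ 2
  have hK0 : 0 < K := by positivity
  refine ⟨8 * K * C, by positivity, fun t ht θ hθ θ' hθ' => ?_⟩
  wlog hle : V a b t θ' ≤ V a b t θ generalizing θ θ'
  · have := this θ' hθ' θ hθ (le_of_not_ge hle)
    simpa only [abs_sub_comm, and_comm] using this
  have ht0 := ht.1
  have hWint : ∀ {a b : ℝ}, -1 < a → -1 < b → ∀ θ : ℝ,
      IntegrableOn (fun η => jacobiWeight a b (θ + η)) (Ioo (-t) t) := fun ha hb θ =>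
    ((integrable_jacobiWeight ha hb).comp_add_left θ).integrableOn
  have hVint : ∀ a b θ : ℝ, V a b t θ = ∫ η in Ioo (-t) t, jacobiWeight a b (θ + η) :=
    fun a b θ => by rw [V_eq_setIntegral, setIntegral_Ioo_comp_add_left _ ht0.le]
  have hsq : ∀ x, √(jacobiWeight a b x) ^ 2 = jacobiWeight a b x := fun x =>
    Real.sq_sqrt (jacobiWeight_nonneg a b x)
  have hVsq : ∀ θ : ℝ, V a b t θ = ∫ η in Ioo (-t) t, √(jacobiWeight a b (θ + η)) ^ 2 :=
    fun θ => by simp only [hsq, hVint]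
  have hf : ∀ θ : ℝ, IntegrableOn (fun η => √(jacobiWeight a b (θ + η)) ^ 2) (Ioo (-t) t) :=
    fun θ => by simpa only [hsq] using hWint (by linarith) (by linarith) θ
  have hmeas : ∀ θ : ℝ, Measurable fun η => √(jacobiWeight a b (θ + η)) := fun θ =>
    ((measurable_jacobiWeight a b).comp (measurable_const_add θ)).sqrt
  have hmem : ∀ θ : ℝ, MemLp (fun η => √(jacobiWeight a b (θ + η))) 2
      (volume.restrict (Ioo (-t) t)) := fun θ =>
    (memLp_two_iff_integrable_sq (hmeas θ).aestronglyMeasurable).2 (hf θ)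
  have hpos := V_pos (a := a) (b := b) (by linarith) (by linarith) ht0 hθ
  have hpos' := V_pos (a := a) (b := b) (by linarith) (by linarith) ht0 hθ'
  have hmul : IntegrableOn
      (fun η => √(jacobiWeight a b (θ + η)) * √(jacobiWeight a b (θ' + η))) (Ioo (-t) t) :=
    (hmem θ).integrable_mul (hmem θ')
  have hnorm := integral_sq_normalized_sub_le (hf θ) (hf θ') hmul
    (integral_nonneg fun η => by positivity) (hVsq θ' ▸ hpos') (by rwa [← hVsq, ← hVsq])
  rw [← hVsq, ← hVsq] at hnorm
  have hdiff : ∫ η in Ioo (-t) t,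
      (√(jacobiWeight a b (θ + η)) - √(jacobiWeight a b (θ' + η))) ^ 2 ≤
      K * |θ - θ'| ^ (2 * γ) * (V (a - γ) (b - γ) t θ + V (a - γ) (b - γ) t θ') := by
    have hI := hWint (a := a - γ) (b := b - γ) (by linarith) (by linarith)
    rw [hVint, hVint, ← integral_add (hI θ) (hI θ'), ← integral_const_mul]
    refine integral_mono_of_nonneg (Filter.Eventually.of_forall fun η => sq_nonneg _)
      (((hI θ).add (hI θ')).const_mul _) (Filter.Eventually.of_forall fun η => ?_)
    simpa using sq_sqrt_jacobiWeight_sub_le (a := a) (b := b) hγ₀ hγ₁ (θ + η) (θ' + η)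
  have htγ := Real.rpow_pos_of_pos ht0 (2 * γ)
  calc _ ≤ ∫ η in Ioo (-t) t, (√(jacobiWeight a b (θ + η)) / √(V a b t θ) -
        √(jacobiWeight a b (θ' + η)) / √(V a b t θ')) ^ 2 := by
        refine integral_mono_of_nonneg (Filter.Eventually.of_forall fun η => ?_)
          (MemLp.integrable_sq (by
            simp only [div_eq_inv_mul]
            exact ((hmem θ).const_mul _).sub ((hmem θ').const_mul _)))
          (Filter.Eventually.of_forall fun η => sq_abs_sqrt_Omg_sub_le a b t θ θ' η)
        dsimp only [Pi.zero_apply]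
        split_ifs <;> positivity
    _ ≤ 4 * (K * |θ - θ'| ^ (2 * γ) *
        (C / t ^ (2 * γ) * V a b t θ + C / t ^ (2 * γ) * V a b t θ)) / V a b t θ := by
        refine hnorm.trans ?_
        gcongr
        refine hdiff.trans ?_
        gcongr
        · exact hV t ht θ hθ
        · exact (hV t ht θ' hθ').trans (by gcongr)
    _ = 8 * K * C * (|θ - θ'| / t) ^ (2 * γ) := by
        rw [Real.div_rpow (abs_nonneg _) ht0.le]
        field_simp
        ring

theorem V_eq_of_pi_le (a b : ℝ) {t θ : ℝ} (ht : π ≤ t) (hθ : θ ∈ Ioo 0 π) :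
    V a b t θ = V a b π θ := by
  have hball : ∀ r, π ≤ r → jacobiBall θ r = Ioo 0 π := fun r hr =>
    inter_eq_right.2 (Ioo_subset_Ioo (by linarith [hθ.2]) (by linarith [hθ.1]))
  rw [V, V, hball t ht, hball π le_rfl]

theorem stmt_2 (α β γ : ℝ) (hα : -1 < α) (hβ : -1 < β)
    (hγ₀ : 0 < γ) (hγ₁ : γ ≤ 1 / 2) (hγ : γ < min α β + 1) :
    ∃ C : ℝ, 0 < C ∧
      ∀ t : ℝ, 0 < t → ∀ θ ∈ Ioo (0 : ℝ) π, ∀ θ' ∈ Ioo (0 : ℝ) π,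
        (t ≤ π →
          (∫ η in Ioo (-t) t,
            (if θ + η ∈ Ioo (0 : ℝ) π ∧ θ' + η ∈ Ioo (0 : ℝ) π then
              |Real.sqrt (Omg α β t θ η) - Real.sqrt (Omg α β t θ' η)| ^ 2 else 0))
            ≤ C * (|θ - θ'| / t) ^ (2 * γ)) ∧
        (π ≤ t →
          (∫ η in Ioo (-t) t,
            (if θ + η ∈ Ioo (0 : ℝ) π ∧ θ' + η ∈ Ioo (0 : ℝ) π then
              |Real.sqrt (Omg α β t θ η) - Real.sqrt (Omg α β t θ' η)| ^ 2 else 0))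
            ≤ C * |θ - θ'| ^ (2 * γ)) := by
  obtain ⟨C, hC, h⟩ := exists_integral_sqrt_Omg_sub_le (a := α) (b := β)
    (by linarith [min_le_left α β]) (by linarith [min_le_right α β]) hγ₀ (by linarith)
  refine ⟨C, hC, fun t ht θ hθ θ' hθ' => ⟨fun htπ => h t ⟨ht, htπ⟩ θ hθ θ' hθ', fun htπ => ?_⟩⟩
  simp only [Omg, V_eq_of_pi_le α β htπ hθ, V_eq_of_pi_le α β htπ hθ']
  rw [setIntegral_eq_of_subset_of_forall_sdiff_eq_zero measurableSet_Ioo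
    (Ioo_subset_Ioo (neg_le_neg htπ) htπ)]
  · refine (h π ⟨Real.pi_pos, le_rfl⟩ θ hθ θ' hθ').trans ?_
    gcongr
    exact div_le_self (abs_nonneg _) (by linarith [Real.pi_gt_three])
  · intro η hη
    refine if_neg fun hmem => hη.2 ⟨?_, ?_⟩
    · linarith [hmem.1.1, hθ.2]
    · linarith [hmem.1.2, hθ.1]
end

section
/- Let α, β > −1 and let γ ∈ (0,1/2] satisfy γ ≤ min(α,β)+1. Then there exists a constant C > 0 such that for all t > 0 and all θ, θ' ∈ (0,π): ∫_{|η|<t} 1_{{θ+η ∈ (0,π) and θ'+η ∉ (0,π)}} Ω_t^{α,β}(θ,η) dη ≤ C (|θ−θ'|/t)^{2γ} when t ∈ (0,π], and ≤ C |θ−θ'|^{2γ} when t ≥ π. -/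
open Real Set MeasureTheory

/-- The density of `jacobiMeasure α β`. -/
noncomputable def jacobiDensity (α β x : ℝ) : ℝ :=
  (Real.sin (x / 2)) ^ (2 * α + 1) * (Real.cos (x / 2)) ^ (2 * β + 1)

lemma measurable_jacobiDensity (α β : ℝ) : Measurable (jacobiDensity α β) := by
  unfold jacobiDensity
  fun_prop

lemma jacobiDensity_nonneg (α β : ℝ) {x : ℝ} (hx : x ∈ Ioo 0 π) : 0 ≤ jacobiDensity α β x :=
  mul_nonneg (rpow_nonneg (sin_nonneg_of_nonneg_of_le_pi (by linarith [hx.1]) (by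
    linarith [hx.1, hx.2])) _)
    (rpow_nonneg (cos_nonneg_of_mem_Icc ⟨by linarith [hx.1, pi_pos], by linarith [hx.2]⟩) _)

lemma jacobiDensity_pi_sub (α β x : ℝ) : jacobiDensity α β (π - x) = jacobiDensity β α x := by
  have h : (π - x) / 2 = π / 2 - x / 2 := by ring
  simp only [jacobiDensity, h, sin_pi_div_two_sub, cos_pi_div_two_sub, mul_comm]

lemma rpow_mem_Icc_min_max {l u x : ℝ} (a : ℝ) (hl : 0 < l) (hx : x ∈ Icc l u) :
    x ^ a ∈ Icc (min (l ^ a) (u ^ a)) (max (l ^ a) (u ^ a)) := by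
  have hx0 : 0 < x := hl.trans_le hx.1
  rcases le_total 0 a with ha | ha
  · exact ⟨min_le_of_left_le (rpow_le_rpow hl.le hx.1 ha),
      le_max_of_le_right (rpow_le_rpow hx0.le hx.2 ha)⟩
  · exact ⟨min_le_of_right_le (rpow_le_rpow_of_nonpos hx0 hx.2 ha),
      le_max_of_le_left (rpow_le_rpow_of_nonpos hl hx.1 ha)⟩

/-- Away from `π` the Jacobi density is comparable to `x ^ (2 * α + 1)`. -/
lemma exists_jacobiDensity_comparison (α β : ℝ) :
    ∃ c C : ℝ, 0 < c ∧ 0 < C ∧ ∀ x ∈ Ioc 0 (π / 2),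
      c * x ^ (2 * α + 1) ≤ jacobiDensity α β x ∧
        jacobiDensity α β x ≤ C * x ^ (2 * α + 1) := by
  set a := 2 * α + 1 with ha
  set b := 2 * β + 1 with hb
  have hπ := pi_pos
  have hq : 0 < cos (π / 4) := cos_pos_of_mem_Ioo ⟨by linarith, by linarith⟩
  have hi : 0 < π⁻¹ := inv_pos.2 hπ
  refine ⟨min (π⁻¹ ^ a) ((1 / 2) ^ a) * min (cos (π / 4) ^ b) (1 ^ b),
    max (π⁻¹ ^ a) ((1 / 2) ^ a) * max (cos (π / 4) ^ b) (1 ^ b), by positivity, by positivity,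
    fun x ⟨hx0, hx⟩ ↦ ?_⟩
  have hs : sin (x / 2) / x ∈ Icc π⁻¹ (1 / 2) := by
    refine ⟨?_, ?_⟩
    · rw [le_div_iff₀ hx0]
      have := mul_le_sin (x := x / 2) (by linarith) (by linarith)
      calc π⁻¹ * x = 2 / π * (x / 2) := by field_simp
        _ ≤ _ := this
    · rw [div_le_iff₀ hx0]
      linarith [sin_le (x := x / 2) (by linarith)]
  have hc : cos (x / 2) ∈ Icc (cos (π / 4)) 1 :=
    ⟨cos_le_cos_of_nonneg_of_le_pi (by linarith) (by linarith) (by linarith), cos_le_one _⟩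
  have hs' := rpow_mem_Icc_min_max a hi hs
  have hc' := rpow_mem_Icc_min_max b hq hc
  have hd : jacobiDensity α β x = (sin (x / 2) / x) ^ a * cos (x / 2) ^ b * x ^ a := by
    have : sin (x / 2) = sin (x / 2) / x * x := by field_simp
    rw [jacobiDensity, ← ha, ← hb, this, mul_rpow (hi.le.trans hs.1) hx0.le, ← this]
    ring
  rw [hd]
  have h1 : 0 < min (cos (π / 4) ^ b) (1 ^ b) := by positivity
  have h2 : 0 < max (π⁻¹ ^ a) ((1 / 2) ^ a) := by positivity
  have h3 : 0 < min (π⁻¹ ^ a) ((1 / 2) ^ a) := by positivity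
  exact ⟨mul_le_mul_of_nonneg_right (mul_le_mul hs'.1 hc'.1 h1.le (h3.le.trans hs'.1))
      (rpow_nonneg hx0.le _),
    mul_le_mul_of_nonneg_right (mul_le_mul hs'.2 hc'.2 (h1.le.trans hc'.1) h2.le)
      (rpow_nonneg hx0.le _)⟩

lemma integrableOn_rpow_Ioc {a : ℝ} (ha : -1 < a) {u : ℝ} (hu : 0 ≤ u) :
    IntegrableOn (fun x : ℝ ↦ x ^ a) (Ioc 0 u) :=
  (intervalIntegrable_iff_integrableOn_Ioc_of_le hu).1
    (intervalIntegral.intervalIntegrable_rpow' ha)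

lemma setIntegral_jacobiDensity_pi_sub (α β : ℝ) (s : Set ℝ) :
    ∫ x in (fun x ↦ π - x) ⁻¹' s, jacobiDensity β α x = ∫ x in s, jacobiDensity α β x := by
  rw [← (Measure.measurePreserving_sub_left volume π).setIntegral_preimage_emb
    (MeasurableEquiv.subLeft π).measurableEmbedding _ s]
  simp only [jacobiDensity_pi_sub]

lemma integrableOn_jacobiDensity_left {α : ℝ} (β : ℝ) (hα : -1 < α) :
    IntegrableOn (jacobiDensity α β) (Ioc 0 (π / 2)) := by
  obtain ⟨c, C, -, -, h⟩ := exists_jacobiDensity_comparison α β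
  refine ((integrableOn_rpow_Ioc (a := 2 * α + 1) (by linarith)
    (by positivity : 0 ≤ π / 2)).const_mul C).mono'
    (measurable_jacobiDensity α β).aestronglyMeasurable ?_
  filter_upwards [ae_restrict_mem measurableSet_Ioc] with x hx
  rw [norm_of_nonneg (jacobiDensity_nonneg α β ⟨hx.1, by linarith [hx.2, pi_pos]⟩)]
  exact (h x hx).2

lemma integrableOn_jacobiDensity {α β : ℝ} (hα : -1 < α) (hβ : -1 < β) :
    IntegrableOn (jacobiDensity α β) (Ioo 0 π) := by
  have hπ : 0 ≤ π / 2 := by positivity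
  have hright := ((intervalIntegrable_iff_integrableOn_Ioc_of_le hπ).2
    (integrableOn_jacobiDensity_left α hβ)).comp_sub_left π
  simp only [jacobiDensity_pi_sub, sub_zero, sub_half] at hright
  have hleft := (intervalIntegrable_iff_integrableOn_Ioc_of_le hπ).2
    (integrableOn_jacobiDensity_left β hα)
  exact (intervalIntegrable_iff_integrableOn_Ioo_of_le pi_pos.le).1 (hleft.trans hright.symm)

lemma jacobiBall_subset (θ r : ℝ) : jacobiBall θ r ⊆ Ioo 0 π := inter_subset_right

lemma measurableSet_jacobiBall (θ r : ℝ) : MeasurableSet (jacobiBall θ r) :=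
  measurableSet_Ioo.inter measurableSet_Ioo

lemma V_eq_setIntegral_s3 (α β t θ : ℝ) :
    V α β t θ = ∫ x in jacobiBall θ t, jacobiDensity α β x := by
  have hm := measurableSet_jacobiBall θ t
  rw [V, jacobiMeasure, withDensity_apply _ hm, Measure.restrict_restrict hm,
    inter_eq_left.2 (jacobiBall_subset θ t), integral_eq_lintegral_of_nonneg_ae]
  · rfl
  · filter_upwards [ae_restrict_mem hm] with x hx
    exact jacobiDensity_nonneg α β (jacobiBall_subset θ t hx)
  · exact (measurable_jacobiDensity α β).aestronglyMeasurable

lemma setIntegral_jacobiDensity_mono {α β : ℝ} (hα : -1 < α) (hβ : -1 < β) {s u : Set ℝ}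
    (hu : MeasurableSet u) (hsu : s ⊆ u) (huπ : u ⊆ Ioo 0 π) :
    ∫ x in s, jacobiDensity α β x ≤ ∫ x in u, jacobiDensity α β x := by
  refine setIntegral_mono_set ((integrableOn_jacobiDensity hα hβ).mono_set huπ) ?_
    hsu.eventuallyLE
  filter_upwards [ae_restrict_mem hu] with x hx
  exact jacobiDensity_nonneg α β (huπ hx)

lemma setIntegral_jacobiDensity_nonneg (α β : ℝ) {u : Set ℝ} (hu : MeasurableSet u)
    (huπ : u ⊆ Ioo 0 π) : 0 ≤ ∫ x in u, jacobiDensity α β x :=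
  setIntegral_nonneg hu fun _ hx ↦ jacobiDensity_nonneg α β (huπ hx)

/-- The part of a ball of radius `t` within distance `δ` of the endpoint `0` has relative measure
at most a multiple of `(δ / t) ^ s`. -/
lemma exists_setIntegral_jacobiBall_inter_Iic_le {α β s : ℝ} (hα : -1 < α) (hβ : -1 < β)
    (hs₀ : 0 < s) (hs : s ≤ 2 * α + 2) :
    ∃ C : ℝ, 0 < C ∧ ∀ t ∈ Ioc 0 π, ∀ θ ∈ Ioo 0 π, ∀ δ : ℝ, 0 ≤ δ →
      ∫ x in jacobiBall θ t ∩ Iic δ, jacobiDensity α β x ≤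
        C * (δ / t) ^ s * ∫ x in jacobiBall θ t, jacobiDensity α β x := by
  obtain ⟨c, C, hc, hC, hcomp⟩ := exists_jacobiDensity_comparison α β
  have hπ := pi_pos
  have ha : 0 < 2 * α + 2 := by linarith
  set k : ℝ := (1 / 2) ^ (2 * α + 2) - (1 / 4) ^ (2 * α + 2) with hk
  have hk0 : 0 < k := sub_pos.2 (rpow_lt_rpow (by norm_num) (by norm_num) ha)
  refine ⟨max (4 ^ s) (C / (c * k)), by positivity, fun t ⟨ht0, htπ⟩ θ hθ δ hδ ↦ ?_⟩
  have hm := measurableSet_jacobiBall θ t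
  have hsub := jacobiBall_subset θ t
  have hB := setIntegral_jacobiDensity_nonneg α β hm hsub
  rcases le_or_gt (t / 4) δ with h4 | h4
  · refine (setIntegral_jacobiDensity_mono hα hβ hm inter_subset_left hsub).trans
      (le_mul_of_one_le_left hB ?_)
    calc (1 : ℝ) ≤ (4 * (δ / t)) ^ s := one_le_rpow (by
            rw [← mul_div_assoc, one_le_div ht0]; linarith) hs₀.le
      _ = 4 ^ s * (δ / t) ^ s := mul_rpow (by norm_num) (by positivity)
      _ ≤ _ := mul_le_mul_of_nonneg_right (le_max_left _ _) (by positivity)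
  rcases (jacobiBall θ t ∩ Iic δ).eq_empty_or_nonempty with he | ⟨y, hy, hyδ⟩
  · rw [he, Measure.restrict_empty, integral_zero_measure]
    positivity
  have hθt : θ - t < t / 4 := hy.1.1.trans_le (le_trans hyδ h4.le)
  have hrpow (u : ℝ) : ∫ x in (0 : ℝ)..u, x ^ (2 * α + 1) = u ^ (2 * α + 2) / (2 * α + 2) := by
    rw [integral_rpow (Or.inl (by linarith)), show 2 * α + 1 + 1 = 2 * α + 2 by ring,
      zero_rpow ha.ne', sub_zero]
  have hint (u v : ℝ) : IntervalIntegrable (fun x : ℝ ↦ x ^ (2 * α + 1)) volume u v :=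
    intervalIntegral.intervalIntegrable_rpow' (by linarith)
  have hupper : ∫ x in jacobiBall θ t ∩ Iic δ, jacobiDensity α β x ≤
      C * (δ ^ (2 * α + 2) / (2 * α + 2)) := by
    have hδπ : Ioc 0 δ ⊆ Ioo 0 π := fun x hx ↦ ⟨hx.1, by linarith [hx.2]⟩
    refine (setIntegral_jacobiDensity_mono hα hβ measurableSet_Ioc
      (fun x hx ↦ ⟨(hsub hx.1).1, hx.2⟩) hδπ).trans ?_
    rw [← hrpow, intervalIntegral.integral_of_le hδ, ← integral_const_mul]
    exact setIntegral_mono_on ((integrableOn_jacobiDensity hα hβ).mono_set hδπ)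
      ((integrableOn_rpow_Ioc (by linarith) hδ).const_mul C) measurableSet_Ioc
      fun x hx ↦ (hcomp x ⟨hx.1, by linarith [hx.2]⟩).2
  have hlower : c * (t ^ (2 * α + 2) * k / (2 * α + 2)) ≤
      ∫ x in jacobiBall θ t, jacobiDensity α β x := by
    have hle : t / 4 ≤ t / 2 := by linarith
    have hsubB : Ioc (t / 4) (t / 2) ⊆ jacobiBall θ t := fun x hx ↦
      ⟨⟨by linarith [hx.1], by linarith [hx.2, hθ.1]⟩, by linarith [hx.1], by linarith [hx.2]⟩
    refine le_trans ?_ (setIntegral_jacobiDensity_mono hα hβ hm hsubB hsub)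
    have : ∫ x in Ioc (t / 4) (t / 2), x ^ (2 * α + 1) = t ^ (2 * α + 2) * k / (2 * α + 2) := by
      rw [← intervalIntegral.integral_of_le hle, ← intervalIntegral.integral_interval_sub_left
        (hint 0 _) (hint 0 _), hrpow, hrpow, div_eq_mul_one_div t 2, div_eq_mul_one_div t 4,
        mul_rpow ht0.le (by norm_num), mul_rpow ht0.le (by norm_num), hk]
      ring
    rw [← this, ← integral_const_mul]
    exact setIntegral_mono_on
      (((intervalIntegrable_iff_integrableOn_Ioc_of_le hle).1 (hint _ _)).const_mul c)
      ((integrableOn_jacobiDensity hα hβ).mono_set (hsubB.trans hsub)) measurableSet_Ioc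
      fun x hx ↦ (hcomp x ⟨by linarith [hx.1], by linarith [hx.2]⟩).1
  have hδt : (δ / t) ^ (2 * α + 2) ≤ (δ / t) ^ s :=
    rpow_le_rpow_of_exponent_ge' (by positivity) ((div_le_one ht0).2 (by linarith)) hs₀.le hs
  have ht : 0 < t ^ (2 * α + 2) := rpow_pos_of_pos ht0 _
  calc ∫ x in jacobiBall θ t ∩ Iic δ, jacobiDensity α β x
      ≤ C * (δ ^ (2 * α + 2) / (2 * α + 2)) := hupper
    _ = C / (c * k) * (δ / t) ^ (2 * α + 2) * (c * (t ^ (2 * α + 2) * k / (2 * α + 2))) := by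
        rw [div_rpow hδ ht0.le]
        field_simp
    _ ≤ max (4 ^ s) (C / (c * k)) * (δ / t) ^ s *
          ∫ x in jacobiBall θ t, jacobiDensity α β x := by
        gcongr
        exact le_max_right _ _

/-- The integral of `Omg` over the points that leave `(0, π)` under the translation by `θ' - θ`,
as the relative measure of a subset of a ball. -/
lemma setIntegral_ite_Omg_eq (α β t θ θ' : ℝ) :
    (∫ η in Ioo (-t) t,
      (if θ + η ∈ Ioo (0 : ℝ) π ∧ θ' + η ∉ Ioo (0 : ℝ) π then Omg α β t θ η else 0)) =
      (∫ x in jacobiBall θ t ∩ {x | θ' - θ + x ∉ Ioo 0 π}, jacobiDensity α β x) /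
        ∫ x in jacobiBall θ t, jacobiDensity α β x := by
  have hE : MeasurableSet (Ioo (0 : ℝ) π ∩ {x | θ' - θ + x ∉ Ioo 0 π}) :=
    measurableSet_Ioo.inter (measurableSet_Ioo.preimage (measurable_const_add _)).compl
  rw [jacobiBall, inter_assoc, ← setIntegral_indicator hE, ← jacobiBall, ← V_eq_setIntegral_s3,
    ← integral_div, ← (measurePreserving_add_left volume θ).setIntegral_preimage_emb
      (MeasurableEquiv.addLeft θ).measurableEmbedding _ (Ioo (θ - t) (θ + t))]
  have hpre : (fun η ↦ θ + η) ⁻¹' Ioo (θ - t) (θ + t) = Ioo (-t) t := by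
    ext η
    simp only [mem_preimage, mem_Ioo]
    constructor <;> rintro ⟨h1, h2⟩ <;> constructor <;> linarith
  rw [hpre]
  refine integral_congr_ae (Filter.Eventually.of_forall fun η ↦ ?_)
  have : θ' - θ + (θ + η) = θ' + η := by ring
  simp only [indicator, mem_inter_iff, mem_ofPred_eq, this]
  split_ifs
  · rfl
  · simp

lemma jacobiBall_min_pi {θ : ℝ} (hθ : θ ∈ Ioo 0 π) (t : ℝ) :
    jacobiBall θ (min t π) = jacobiBall θ t := by
  rcases le_total t π with h | h
  · rw [min_eq_left h]
  · rw [min_eq_right h]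
    ext x
    simp only [jacobiBall, mem_inter_iff, mem_Ioo, and_congr_left_iff]
    rintro ⟨h1, h2⟩
    constructor <;> rintro - <;> constructor <;> linarith [hθ.1, hθ.2]

lemma exists_setIntegral_ite_Omg_le {α β γ : ℝ} (hα : -1 < α) (hβ : -1 < β)
    (hγ₀ : 0 < γ) (hγ : γ ≤ min α β + 1) :
    ∃ C : ℝ, 0 < C ∧ ∀ t : ℝ, 0 < t → ∀ θ ∈ Ioo (0 : ℝ) π, ∀ θ' : ℝ,
      (∫ η in Ioo (-t) t,
        (if θ + η ∈ Ioo (0 : ℝ) π ∧ θ' + η ∉ Ioo (0 : ℝ) π then Omg α β t θ η else 0)) ≤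
        C * (|θ - θ'| / min t π) ^ (2 * γ) := by
  have hγα : 2 * γ ≤ 2 * α + 2 := by linarith [min_le_left α β]
  have hγβ : 2 * γ ≤ 2 * β + 2 := by linarith [min_le_right α β]
  obtain ⟨C₁, hC₁, h₁⟩ := exists_setIntegral_jacobiBall_inter_Iic_le hα hβ
    (by positivity : 0 < 2 * γ) hγα
  obtain ⟨C₂, hC₂, h₂⟩ := exists_setIntegral_jacobiBall_inter_Iic_le hβ hα
    (by positivity : 0 < 2 * γ) hγβ
  refine ⟨max C₁ C₂, by positivity, fun t ht θ hθ θ' ↦ ?_⟩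
  have htm : min t π ∈ Ioc 0 π := ⟨lt_min ht pi_pos, min_le_right _ _⟩
  have htm0 := htm.1
  have hB := setIntegral_jacobiDensity_nonneg α β (measurableSet_jacobiBall θ t)
    (jacobiBall_subset θ t)
  rw [setIntegral_ite_Omg_eq]
  refine div_le_of_le_mul₀ hB (by positivity) ?_
  have hm := measurableSet_jacobiBall θ t
  rcases le_total θ' θ with h | h
  · have hd := h₁ _ htm θ hθ |θ - θ'| (abs_nonneg _)
    rw [jacobiBall_min_pi hθ] at hd
    refine (setIntegral_jacobiDensity_mono hα hβ (hm.inter measurableSet_Iic) ?_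
      (inter_subset_left.trans (jacobiBall_subset θ t))).trans (hd.trans ?_)
    · refine fun x hx ↦ ⟨hx.1, ?_⟩
      rw [mem_Iic, abs_of_nonneg (sub_nonneg.2 h)]
      by_contra! hlt
      exact hx.2 ⟨by linarith, by linarith [hx.1.2.2]⟩
    · gcongr
      exact le_max_left _ _
  · have hθ'' : π - θ ∈ Ioo 0 π := ⟨by linarith [hθ.2], by linarith [hθ.1]⟩
    have hd := h₂ _ htm (π - θ) hθ'' |θ - θ'| (abs_nonneg _)
    rw [jacobiBall_min_pi hθ''] at hd
    have hball : (fun x ↦ π - x) ⁻¹' jacobiBall θ t = jacobiBall (π - θ) t := by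
      ext x
      simp only [jacobiBall, mem_preimage, mem_inter_iff, mem_Ioo]
      constructor <;> rintro ⟨⟨_, _⟩, _, _⟩ <;> refine ⟨⟨?_, ?_⟩, ?_, ?_⟩ <;> linarith
    have hset : (fun x ↦ π - x) ⁻¹' (jacobiBall θ t ∩ Ici (π - |θ - θ'|)) =
        jacobiBall (π - θ) t ∩ Iic |θ - θ'| := by
      rw [preimage_inter, hball]
      congr 1
      ext x
      simp
    rw [← hset, ← hball, setIntegral_jacobiDensity_pi_sub, setIntegral_jacobiDensity_pi_sub] at hd
    refine (setIntegral_jacobiDensity_mono hα hβ (hm.inter measurableSet_Ici) ?_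
      (inter_subset_left.trans (jacobiBall_subset θ t))).trans (hd.trans ?_)
    · refine fun x hx ↦ ⟨hx.1, ?_⟩
      rw [mem_Ici, abs_of_nonpos (sub_nonpos.2 h)]
      by_contra! hlt
      exact hx.2 ⟨by linarith [hx.1.2.1], by linarith⟩
    · gcongr
      exact le_max_right _ _

theorem stmt_3 (α β γ : ℝ) (hα : -1 < α) (hβ : -1 < β)
    (hγ₀ : 0 < γ) (hγ₁ : γ ≤ 1 / 2) (hγ : γ ≤ min α β + 1) :
    ∃ C : ℝ, 0 < C ∧
      ∀ t : ℝ, 0 < t → ∀ θ ∈ Ioo (0 : ℝ) π, ∀ θ' ∈ Ioo (0 : ℝ) π,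
        (t ≤ π →
          (∫ η in Ioo (-t) t,
            (if θ + η ∈ Ioo (0 : ℝ) π ∧ θ' + η ∉ Ioo (0 : ℝ) π then Omg α β t θ η else 0))
            ≤ C * (|θ - θ'| / t) ^ (2 * γ)) ∧
        (π ≤ t →
          (∫ η in Ioo (-t) t,
            (if θ + η ∈ Ioo (0 : ℝ) π ∧ θ' + η ∉ Ioo (0 : ℝ) π then Omg α β t θ η else 0))
            ≤ C * |θ - θ'| ^ (2 * γ)) := by
  obtain ⟨C, hC, h⟩ := exists_setIntegral_ite_Omg_le hα hβ hγ₀ hγ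
  refine ⟨C, hC, fun t ht θ hθ θ' _ ↦ ⟨fun htπ ↦ ?_, fun htπ ↦ ?_⟩⟩
  · simpa only [min_eq_left htπ] using h t ht θ hθ θ'
  · refine (h t ht θ hθ θ').trans ?_
    rw [min_eq_right htπ]
    gcongr
    exact div_le_self (abs_nonneg _) (by linarith [pi_gt_three])
end

section
/- Let α, β > −1 and let W, s ∈ ℝ be fixed. Then there exist constants c, C > 0 such that: (i) for all t ∈ (0,π] and all θ, θ̃, φ ∈ (0,π) with |θ−φ| > 2|θ−θ̃|, one has c·Υ_{W,s}^{α,β}(t,θ,φ) ≤ Υ_{W,s}^{α,β}(t,θ̃,φ) ≤ C·Υ_{W,s}^{α,β}(t,θ,φ); and (ii) for all t ∈ (0,π] and all θ, φ, φ̃ ∈ (0,π) with |θ−φ| > 2|φ−φ̃|, one has c·Υ_{W,s}^{α,β}(t,θ,φ) ≤ Υ_{W,s}^{α,β}(t,θ,φ̃) ≤ C·Υ_{W,s}^{α,β}(t,θ,φ). -/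
open Real Set MeasureTheory

/-- The measure `Π_a` on `[−1,1]`: for `a > −1/2` it has density
`Γ(a+1)/(√π Γ(a+1/2)) (1−u²)^{a−1/2}`, and `Π_{−1/2}` is `(δ_{−1}+δ_1)/2`. -/
noncomputable def jacobiPi (a : ℝ) : Measure ℝ :=
  if a = -(1 / 2) then
    (2 : ENNReal)⁻¹ • (Measure.dirac (-1) + Measure.dirac 1)
  else
    (volume.restrict (Icc (-1 : ℝ) 1)).withDensity
      (fun u => ENNReal.ofReal
        (Real.Gamma (a + 1) / (Real.sqrt π * Real.Gamma (a + 1 / 2)) * (1 - u ^ 2) ^ (a - 1 / 2)))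

/-- `Π_a^K`: equals `Π_{−1/2}` if `K = 0` and `Π_{a+1}` if `K = 1`. -/
noncomputable def jacobiPiK (a : ℝ) (K : ℕ) : Measure ℝ :=
  if K = 0 then jacobiPi (-(1 / 2)) else jacobiPi (a + 1)

/-- The function `Υ_{W,s}^{α,β}(t,θ,φ)`, defined by cases according to the
positions of `α, β` relative to `−1/2`. -/
noncomputable def Ups (α β W s t θ φ : ℝ) : ℝ :=
  if -(1 / 2) ≤ α then
    if -(1 / 2) ≤ β then
      ∫ u, ∫ v, (t ^ 2 + q θ φ u v) ^ (-(α + β + 3 / 2 + W / 4 + s / 2))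
        ∂(jacobiPi β) ∂(jacobiPi α)
    else
      1 + ∑ R ∈ Finset.range 2, ∑ r ∈ Finset.range 3,
        (Real.cos (θ / 2) + Real.cos (φ / 2)) ^ (R * r) *
        ∫ u, ∫ v,
          (t ^ 2 + q θ φ u v) ^ (-(α + β + 3 / 2 + W / 4 + ((R * r : ℕ) : ℝ) / 2 + s / 2))
          ∂(jacobiPiK β R) ∂(jacobiPi α)
  else
    if -(1 / 2) ≤ β then
      1 + ∑ K ∈ Finset.range 2, ∑ k ∈ Finset.range 3,
        (Real.sin (θ / 2) + Real.sin (φ / 2)) ^ (K * k) *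
        ∫ u, ∫ v,
          (t ^ 2 + q θ φ u v) ^ (-(α + β + 3 / 2 + W / 4 + ((K * k : ℕ) : ℝ) / 2 + s / 2))
          ∂(jacobiPi β) ∂(jacobiPiK α K)
    else
      1 + ∑ K ∈ Finset.range 2, ∑ R ∈ Finset.range 2, ∑ k ∈ Finset.range 3, ∑ r ∈ Finset.range 3,
        (Real.sin (θ / 2) + Real.sin (φ / 2)) ^ (K * k) *
        (Real.cos (θ / 2) + Real.cos (φ / 2)) ^ (R * r) *
        ∫ u, ∫ v,
          (t ^ 2 + q θ φ u v) ^
            (-(α + β + 3 / 2 + W / 4 + ((K * k : ℕ) : ℝ) / 2 + ((R * r : ℕ) : ℝ) / 2 + s / 2))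
          ∂(jacobiPiK β R) ∂(jacobiPiK α K)

lemma q_comm (θ φ u v : ℝ) : q θ φ u v = q φ θ u v := by
  unfold q; ring

lemma Ups_comm (α β W s t θ φ : ℝ) : Ups α β W s t θ φ = Ups α β W s t φ θ := by
  simp only [Ups, q_comm θ φ, add_comm (Real.cos (θ / 2)), add_comm (Real.sin (θ / 2))]

instance sFinite_jacobiPi (a : ℝ) : SFinite (jacobiPi a) := by
  unfold jacobiPi
  split_ifs <;> infer_instance

instance sFinite_jacobiPiK (a : ℝ) (K : ℕ) : SFinite (jacobiPiK a K) := by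
  unfold jacobiPiK
  split_ifs <;> infer_instance

lemma ae_jacobiPi_mem_Icc (a : ℝ) : ∀ᵐ u ∂(jacobiPi a), u ∈ Icc (-1 : ℝ) 1 := by
  unfold jacobiPi
  split_ifs
  · refine Measure.ae_smul_measure ?_ _
    rw [ae_add_measure_iff]
    constructor <;> simp [ae_dirac_eq]
  · exact (withDensity_absolutelyContinuous _ _).ae_le (ae_restrict_mem measurableSet_Icc)

lemma ae_jacobiPiK_mem_Icc (a : ℝ) (K : ℕ) : ∀ᵐ u ∂(jacobiPiK a K), u ∈ Icc (-1 : ℝ) 1 := by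
  unfold jacobiPiK
  split_ifs <;> exact ae_jacobiPi_mem_Icc _

/-- The points `θ` and `θ'` have comparable distances to `φ`, to `-φ` and to `2π - φ`. -/
structure Comparable (θ θ' φ : ℝ) : Prop where
  mem_left : θ ∈ Ioo 0 π
  mem_right : θ' ∈ Ioo 0 π
  mem : φ ∈ Ioo 0 π
  sub_le : |θ - φ| ≤ 2 * |θ' - φ|
  le_sub : |θ' - φ| ≤ 2 * |θ - φ|
  add_le : θ + φ ≤ 2 * (θ' + φ)
  le_add : θ' + φ ≤ 2 * (θ + φ)
  compl_le : (π - θ) + (π - φ) ≤ 2 * ((π - θ') + (π - φ))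
  le_compl : (π - θ') + (π - φ) ≤ 2 * ((π - θ) + (π - φ))

lemma Comparable.symm {θ θ' φ : ℝ} (h : Comparable θ θ' φ) : Comparable θ' θ φ :=
  ⟨h.mem_right, h.mem_left, h.mem, h.le_sub, h.sub_le, h.le_add, h.add_le, h.le_compl, h.compl_le⟩

lemma Comparable.of_two_mul_abs_lt {θ θ' φ : ℝ} (hθ : θ ∈ Ioo 0 π) (hθ' : θ' ∈ Ioo 0 π)
    (hφ : φ ∈ Ioo 0 π) (h : 2 * |θ - θ'| < |θ - φ|) : Comparable θ θ' φ := by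
  obtain ⟨h1, h2⟩ := hθ
  obtain ⟨h3, h4⟩ := hθ'
  obtain ⟨h5, h6⟩ := hφ
  refine ⟨⟨h1, h2⟩, ⟨h3, h4⟩, ⟨h5, h6⟩, ?_, ?_, ?_, ?_, ?_, ?_⟩ <;>
  rcases abs_cases (θ - θ') with ⟨e1, _⟩ | ⟨e1, _⟩ <;>
  rcases abs_cases (θ - φ) with ⟨e2, _⟩ | ⟨e2, _⟩ <;>
  rcases abs_cases (θ' - φ) with ⟨e3, _⟩ | ⟨e3, _⟩ <;>
  linarith

lemma one_sub_cos_half_le {x y : ℝ} (hxy : |x| ≤ 2 * |y|) (hy : |y| ≤ 2 * π) :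
    1 - Real.cos (x / 2) ≤ 16 * (1 - Real.cos (y / 2)) := by
  have h1 := Real.one_sub_sq_div_two_le_cos (x := x / 2)
  have h2 : Real.cos (y / 2) ≤ 1 - 2 / π ^ 2 * (y / 2) ^ 2 :=
    Real.cos_le_one_sub_mul_cos_sq (by rw [abs_div, abs_two]; linarith)
  have h3 : x ^ 2 ≤ 4 * y ^ 2 := by
    rw [← sq_abs x, ← sq_abs y]
    nlinarith [abs_nonneg x, abs_nonneg y]
  have h4 : 1 / 8 ≤ 2 / π ^ 2 := by
    rw [div_le_div_iff₀ (by norm_num) (by positivity)]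
    nlinarith [Real.pi_le_four, Real.pi_pos]
  nlinarith [mul_le_mul_of_nonneg_right h4 (sq_nonneg (y / 2))]

lemma affine_nonneg {a b u : ℝ} (hu : u ∈ Icc (-1 : ℝ) 1) (h₁ : 0 ≤ a + b) (h₂ : 0 ≤ a - b) :
    0 ≤ a + u * b := by
  nlinarith [mul_nonneg (sub_nonneg.2 hu.2) h₂,
    mul_nonneg (neg_le_iff_add_nonneg.1 hu.1) h₁]

lemma q_nonneg (θ φ : ℝ) {u v : ℝ} (hu : u ∈ Icc (-1 : ℝ) 1) (hv : v ∈ Icc (-1 : ℝ) 1) :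
    0 ≤ q θ φ u v := by
  have h1 := Real.cos_sub (θ / 2) (φ / 2)
  have h2 := Real.cos_add (θ / 2) (φ / 2)
  have h3 := Real.cos_le_one (θ / 2 - φ / 2)
  have h4 := Real.cos_le_one (θ / 2 + φ / 2)
  have h5 := Real.neg_one_le_cos (θ / 2 - φ / 2)
  have h6 := Real.neg_one_le_cos (θ / 2 + φ / 2)
  have key := affine_nonneg (a := 1 + v * (-(Real.cos (θ / 2) * Real.cos (φ / 2))))
    (b := -(Real.sin (θ / 2) * Real.sin (φ / 2))) hu
    (by
      have := affine_nonneg (a := 1 - Real.sin (θ / 2) * Real.sin (φ / 2))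
        (b := -(Real.cos (θ / 2) * Real.cos (φ / 2))) hv (by linarith) (by linarith)
      linarith)
    (by
      have := affine_nonneg (a := 1 + Real.sin (θ / 2) * Real.sin (φ / 2))
        (b := -(Real.cos (θ / 2) * Real.cos (φ / 2))) hv (by linarith) (by linarith)
      linarith)
  unfold q
  linarith

lemma Comparable.q_le {θ θ' φ u v : ℝ} (h : Comparable θ θ' φ) (hu : u ∈ Icc (-1 : ℝ) 1)
    (hv : v ∈ Icc (-1 : ℝ) 1) : q θ φ u v ≤ 16 * q θ' φ u v := by
  obtain ⟨⟨h1, h2⟩, ⟨h3, h4⟩, ⟨h5, h6⟩, hs, -, ha, -, hc, -⟩ := h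
  have k1 : 1 - Real.cos (θ / 2 - φ / 2) ≤ 16 * (1 - Real.cos (θ' / 2 - φ / 2)) := by
    have := one_sub_cos_half_le hs (abs_le.2 ⟨by linarith, by linarith⟩)
    rwa [sub_div, sub_div] at this
  have k2 : 1 - Real.cos (θ / 2 + φ / 2) ≤ 16 * (1 - Real.cos (θ' / 2 + φ / 2)) := by
    have := one_sub_cos_half_le (x := θ + φ) (y := θ' + φ)
      (by rwa [abs_of_pos (by linarith), abs_of_pos (by linarith)])
      (abs_le.2 ⟨by linarith, by linarith⟩)
    rwa [add_div, add_div] at this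
  have k3 : 1 + Real.cos (θ / 2 + φ / 2) ≤ 16 * (1 + Real.cos (θ' / 2 + φ / 2)) := by
    have := one_sub_cos_half_le (x := (π - θ) + (π - φ)) (y := (π - θ') + (π - φ))
      (by rwa [abs_of_pos (by linarith), abs_of_pos (by linarith)])
      (abs_le.2 ⟨by linarith, by linarith⟩)
    rw [show ((π - θ) + (π - φ)) / 2 = π - (θ / 2 + φ / 2) by ring,
      show ((π - θ') + (π - φ)) / 2 = π - (θ' / 2 + φ / 2) by ring,
      Real.cos_pi_sub, Real.cos_pi_sub] at this
    linarith
  have k4 : 1 + Real.cos (θ / 2 - φ / 2) ≤ 16 * (1 + Real.cos (θ' / 2 - φ / 2)) := by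
    have := Real.cos_nonneg_of_mem_Icc (x := θ' / 2 - φ / 2) ⟨by linarith, by linarith⟩
    linarith [Real.cos_le_one (θ / 2 - φ / 2)]
  rw [Real.cos_sub, Real.cos_sub] at k1 k4
  rw [Real.cos_add, Real.cos_add] at k2 k3
  set S := 16 * (Real.sin (θ' / 2) * Real.sin (φ / 2)) - Real.sin (θ / 2) * Real.sin (φ / 2)
    with hS
  set T := 16 * (Real.cos (θ' / 2) * Real.cos (φ / 2)) - Real.cos (θ / 2) * Real.cos (φ / 2)
    with hT
  have key := affine_nonneg (a := 15 + v * (-T)) (b := -S) hu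
    (by linarith [affine_nonneg (a := 15 - S) (b := -T) hv (by linarith) (by linarith)])
    (by linarith [affine_nonneg (a := 15 + S) (b := -T) hv (by linarith) (by linarith)])
  unfold q
  rw [hS, hT] at key
  linarith

lemma rpow_le_rpow_abs_mul {A B K : ℝ} (p : ℝ) (hA : 0 < A) (hB : 0 < B) (hK : 1 ≤ K)
    (hAB : A ≤ K * B) (hBA : B ≤ K * A) : A ^ p ≤ K ^ |p| * B ^ p := by
  have hK0 : 0 < K := by linarith
  rcases le_total 0 p with hp | hp
  · rw [abs_of_nonneg hp, ← Real.mul_rpow hK0.le hB.le]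
    exact Real.rpow_le_rpow hA.le hAB hp
  · rw [abs_of_nonpos hp, Real.rpow_neg hK0.le, ← Real.inv_rpow hK0.le,
      ← Real.mul_rpow (by positivity) hB.le]
    refine Real.rpow_le_rpow_of_nonpos (by positivity) ?_ hp
    rw [inv_mul_le_iff₀ hK0]
    exact hBA

/-- Mutual domination transfers integrability, so no integrability hypothesis is needed. -/
lemma integral_le_mul_integral_of_comparable {X : Type*} [MeasurableSpace X] {μ : Measure X}
    {f g : X → ℝ} {C : ℝ} (hg : AEStronglyMeasurable g μ)
    (hf0 : 0 ≤ᵐ[μ] f) (hg0 : 0 ≤ᵐ[μ] g) (hfg : ∀ᵐ x ∂μ, f x ≤ C * g x)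
    (hgf : ∀ᵐ x ∂μ, g x ≤ C * f x) : ∫ x, f x ∂μ ≤ C * ∫ x, g x ∂μ := by
  by_cases hi : Integrable g μ
  · rw [← integral_const_mul]
    exact integral_mono_of_nonneg hf0 (hi.const_mul C) hfg
  · have hi' : ¬ Integrable f μ := by
      refine fun h => hi ((h.const_mul C).mono' hg ?_)
      filter_upwards [hg0, hgf] with x h0 h1
      rwa [Real.norm_of_nonneg h0]
    rw [integral_undef hi, integral_undef hi', mul_zero]

/-- `F` is nonnegative and changes at most by a constant factor between comparable points. -/
def Stable (F : ℝ → ℝ → ℝ → ℝ) : Prop :=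
  (∀ t θ φ, 0 < t → θ ∈ Ioo 0 π → φ ∈ Ioo 0 π → 0 ≤ F t θ φ) ∧
  ∃ C, 0 < C ∧ ∀ t θ θ' φ, 0 < t → Comparable θ θ' φ → F t θ φ ≤ C * F t θ' φ

lemma Stable.one : Stable fun _ _ _ => 1 :=
  ⟨fun _ _ _ _ _ _ => zero_le_one, 1, one_pos, fun _ _ _ _ _ _ => by norm_num⟩

lemma Stable.add {F G : ℝ → ℝ → ℝ → ℝ} (hF : Stable F) (hG : Stable G) :
    Stable fun t θ φ => F t θ φ + G t θ φ := by
  obtain ⟨hF0, C, hC, hF⟩ := hF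
  obtain ⟨hG0, D, hD, hG⟩ := hG
  refine ⟨fun t θ φ ht hθ hφ => add_nonneg (hF0 t θ φ ht hθ hφ) (hG0 t θ φ ht hθ hφ),
    C + D, by positivity, fun t θ θ' φ ht h => ?_⟩
  have h1 := hF t θ θ' φ ht h
  have h2 := hG t θ θ' φ ht h
  have h3 := mul_nonneg hC.le (hG0 t θ' φ ht h.mem_right h.mem)
  have h4 := mul_nonneg hD.le (hF0 t θ' φ ht h.mem_right h.mem)
  linarith

lemma Stable.mul {F G : ℝ → ℝ → ℝ → ℝ} (hF : Stable F) (hG : Stable G) :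
    Stable fun t θ φ => F t θ φ * G t θ φ := by
  obtain ⟨hF0, C, hC, hF⟩ := hF
  obtain ⟨hG0, D, hD, hG⟩ := hG
  refine ⟨fun t θ φ ht hθ hφ => mul_nonneg (hF0 t θ φ ht hθ hφ) (hG0 t θ φ ht hθ hφ),
    C * D, by positivity, fun t θ θ' φ ht h => ?_⟩
  calc F t θ φ * G t θ φ ≤ (C * F t θ' φ) * (D * G t θ' φ) :=
        mul_le_mul (hF t θ θ' φ ht h) (hG t θ θ' φ ht h) (hG0 t θ φ ht h.mem_left h.mem)
          (mul_nonneg hC.le (hF0 t θ' φ ht h.mem_right h.mem))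
    _ = C * D * (F t θ' φ * G t θ' φ) := by ring

lemma Stable.pow {F : ℝ → ℝ → ℝ → ℝ} (hF : Stable F) (n : ℕ) :
    Stable fun t θ φ => F t θ φ ^ n := by
  induction n with
  | zero => simpa using Stable.one
  | succ n ih => simpa only [pow_succ] using ih.mul hF

lemma Stable.sum {F : ℕ → ℝ → ℝ → ℝ → ℝ} (n : ℕ) (hF : ∀ i, Stable (F i)) :
    Stable fun t θ φ => ∑ i ∈ Finset.range n, F i t θ φ := by
  induction n with
  | zero =>
    exact ⟨fun _ _ _ _ _ _ => by simp, 1, one_pos, fun _ _ _ _ _ _ => by simp⟩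
  | succ n ih => simpa only [Finset.sum_range_succ] using ih.add (hF n)

lemma sin_half_add_sin_half_le {x x' y : ℝ} (hx : 0 < x) (hx' : x' ∈ Ioo 0 π) (hy : y ∈ Ioo 0 π)
    (h : x + y ≤ 2 * (x' + y)) :
    Real.sin (x / 2) + Real.sin (y / 2) ≤ π * (Real.sin (x' / 2) + Real.sin (y / 2)) := by
  have h1 := Real.sin_le (x := x / 2) (by linarith)
  have h2 := Real.sin_le (x := y / 2) (by linarith [hy.1])
  have h3 := Real.mul_le_sin (x := x' / 2) (by linarith [hx'.1]) (by linarith [hx'.2])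
  have h4 := Real.mul_le_sin (x := y / 2) (by linarith [hy.1]) (by linarith [hy.2])
  have h5 : x' + y = π * (2 / π * (x' / 2) + 2 / π * (y / 2)) := by
    have := Real.pi_pos.ne'
    field_simp
  have h6 := mul_le_mul_of_nonneg_left (add_le_add h3 h4) Real.pi_pos.le
  linarith

lemma stable_sin_add_sin : Stable fun _ θ φ => Real.sin (θ / 2) + Real.sin (φ / 2) := by
  refine ⟨fun t θ φ _ hθ hφ => ?_, π, Real.pi_pos, fun t θ θ' φ _ h => ?_⟩
  · have h1 := Real.sin_nonneg_of_nonneg_of_le_pi (x := θ / 2) (by linarith [hθ.1])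
      (by linarith [hθ.1, hθ.2])
    have h2 := Real.sin_nonneg_of_nonneg_of_le_pi (x := φ / 2) (by linarith [hφ.1])
      (by linarith [hφ.1, hφ.2])
    exact add_nonneg h1 h2
  · exact sin_half_add_sin_half_le h.mem_left.1 h.mem_right h.mem h.add_le

lemma stable_cos_add_cos : Stable fun _ θ φ => Real.cos (θ / 2) + Real.cos (φ / 2) := by
  refine ⟨fun t θ φ _ hθ hφ => ?_, π, Real.pi_pos, fun t θ θ' φ _ h => ?_⟩
  · have h1 := Real.cos_nonneg_of_mem_Icc (x := θ / 2) ⟨by linarith [hθ.1, hθ.2],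
      by linarith [hθ.2]⟩
    have h2 := Real.cos_nonneg_of_mem_Icc (x := φ / 2) ⟨by linarith [hφ.1, hφ.2],
      by linarith [hφ.2]⟩
    exact add_nonneg h1 h2
  · have key := sin_half_add_sin_half_le (x := π - θ) (x' := π - θ') (y := π - φ)
      (by linarith [h.mem_left.2]) ⟨by linarith [h.mem_right.2], by linarith [h.mem_right.1]⟩
      ⟨by linarith [h.mem.2], by linarith [h.mem.1]⟩ h.compl_le
    simpa only [sub_div, Real.sin_pi_div_two_sub] using key

lemma stable_integral {μ ν : Measure ℝ} [SFinite ν] (hμ : ∀ᵐ u ∂μ, u ∈ Icc (-1 : ℝ) 1)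
    (hν : ∀ᵐ v ∂ν, v ∈ Icc (-1 : ℝ) 1) (p : ℝ) :
    Stable fun t θ φ => ∫ u, ∫ v, (t ^ 2 + q θ φ u v) ^ p ∂ν ∂μ := by
  have hpos : ∀ t θ φ : ℝ, ∀ {u v : ℝ}, u ∈ Icc (-1 : ℝ) 1 → v ∈ Icc (-1 : ℝ) 1 →
      0 ≤ (t ^ 2 + q θ φ u v) ^ p := fun t θ φ u v hu hv =>
    Real.rpow_nonneg (by linarith [sq_nonneg t, q_nonneg θ φ hu hv]) p
  have hinner : ∀ t θ φ : ℝ, ∀ {u : ℝ}, u ∈ Icc (-1 : ℝ) 1 →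
      0 ≤ ∫ v, (t ^ 2 + q θ φ u v) ^ p ∂ν := fun t θ φ u hu =>
    integral_nonneg_of_ae (hν.mono fun v hv => hpos t θ φ hu hv)
  have hmeas : ∀ t θ φ : ℝ, Measurable fun z : ℝ × ℝ => (t ^ 2 + q θ φ z.1 z.2) ^ p := by
    intro t θ φ
    unfold q
    fun_prop
  have hmeas' : ∀ t θ φ u : ℝ, AEStronglyMeasurable (fun v => (t ^ 2 + q θ φ u v) ^ p) ν :=
    fun t θ φ u => ((hmeas t θ φ).comp measurable_prodMk_left).aestronglyMeasurable
  have hmeas'' : ∀ t θ φ : ℝ,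
      AEStronglyMeasurable (fun u => ∫ v, (t ^ 2 + q θ φ u v) ^ p ∂ν) μ := fun t θ φ =>
    ((hmeas t θ φ).stronglyMeasurable.integral_prod_right).aestronglyMeasurable
  have hle : ∀ t θ θ' φ : ℝ, ∀ {u v : ℝ}, 0 < t → Comparable θ θ' φ → u ∈ Icc (-1 : ℝ) 1 →
      v ∈ Icc (-1 : ℝ) 1 →
      (t ^ 2 + q θ φ u v) ^ p ≤ 16 ^ |p| * (t ^ 2 + q θ' φ u v) ^ p := by
    intro t θ θ' φ u v ht h hu hv
    have h0 : 0 < t ^ 2 := by positivity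
    have h1 := q_nonneg θ φ hu hv
    have h2 := q_nonneg θ' φ hu hv
    have h3 := h.q_le hu hv
    have h4 := h.symm.q_le hu hv
    exact rpow_le_rpow_abs_mul p (by linarith) (by linarith) (by norm_num) (by linarith)
      (by linarith)
  have hle' : ∀ t θ θ' φ : ℝ, ∀ {u : ℝ}, 0 < t → Comparable θ θ' φ → u ∈ Icc (-1 : ℝ) 1 →
      ∫ v, (t ^ 2 + q θ φ u v) ^ p ∂ν ≤ 16 ^ |p| * ∫ v, (t ^ 2 + q θ' φ u v) ^ p ∂ν := by
    intro t θ θ' φ u ht h hu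
    exact integral_le_mul_integral_of_comparable (hmeas' t θ' φ u)
      (hν.mono fun v hv => hpos t θ φ hu hv) (hν.mono fun v hv => hpos t θ' φ hu hv)
      (hν.mono fun v hv => hle t θ θ' φ ht h hu hv)
      (hν.mono fun v hv => hle t θ' θ φ ht h.symm hu hv)
  refine ⟨fun t θ φ _ _ _ => integral_nonneg_of_ae (hμ.mono fun u hu => hinner t θ φ hu),
    16 ^ |p|, by positivity, fun t θ θ' φ ht h => ?_⟩
  exact integral_le_mul_integral_of_comparable (hmeas'' t θ' φ)
    (hμ.mono fun u hu => hinner t θ φ hu) (hμ.mono fun u hu => hinner t θ' φ hu)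
    (hμ.mono fun u hu => hle' t θ θ' φ ht h hu)
    (hμ.mono fun u hu => hle' t θ' θ φ ht h.symm hu)

lemma stable_Ups (α β W s : ℝ) : Stable (Ups α β W s) := by
  unfold Ups
  split_ifs
  · exact stable_integral (ae_jacobiPi_mem_Icc _) (ae_jacobiPi_mem_Icc _) _
  · exact Stable.one.add (Stable.sum 2 fun _ => Stable.sum 3 fun _ =>
      (stable_cos_add_cos.pow _).mul
        (stable_integral (ae_jacobiPi_mem_Icc _) (ae_jacobiPiK_mem_Icc _ _) _))
  · exact Stable.one.add (Stable.sum 2 fun _ => Stable.sum 3 fun _ =>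
      (stable_sin_add_sin.pow _).mul
        (stable_integral (ae_jacobiPiK_mem_Icc _ _) (ae_jacobiPi_mem_Icc _) _))
  · exact Stable.one.add (Stable.sum 2 fun _ => Stable.sum 2 fun _ => Stable.sum 3 fun _ =>
      Stable.sum 3 fun _ => ((stable_sin_add_sin.pow _).mul (stable_cos_add_cos.pow _)).mul
        (stable_integral (ae_jacobiPiK_mem_Icc _ _) (ae_jacobiPiK_mem_Icc _ _) _))

theorem stmt_4 (α β W s : ℝ) (hα : -1 < α) (hβ : -1 < β) :
    ∃ c C : ℝ, 0 < c ∧ 0 < C ∧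
      (∀ t θ θt φ : ℝ, t ∈ Ioc 0 π → θ ∈ Ioo 0 π → θt ∈ Ioo 0 π → φ ∈ Ioo 0 π →
        |θ - φ| > 2 * |θ - θt| →
          c * Ups α β W s t θ φ ≤ Ups α β W s t θt φ ∧
          Ups α β W s t θt φ ≤ C * Ups α β W s t θ φ) ∧
      (∀ t θ φ φt : ℝ, t ∈ Ioc 0 π → θ ∈ Ioo 0 π → φ ∈ Ioo 0 π → φt ∈ Ioo 0 π →
        |θ - φ| > 2 * |φ - φt| →
          c * Ups α β W s t θ φ ≤ Ups α β W s t θ φt ∧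
          Ups α β W s t θ φt ≤ C * Ups α β W s t θ φ) := by
  obtain ⟨-, C, hC, hU⟩ := stable_Ups α β W s
  have key : ∀ t θ θt φ : ℝ, t ∈ Ioc 0 π → θ ∈ Ioo 0 π → θt ∈ Ioo 0 π → φ ∈ Ioo 0 π →
      |θ - φ| > 2 * |θ - θt| →
        C⁻¹ * Ups α β W s t θ φ ≤ Ups α β W s t θt φ ∧
        Ups α β W s t θt φ ≤ C * Ups α β W s t θ φ := by
    intro t θ θt φ ht hθ hθt hφ h
    have hcomp := Comparable.of_two_mul_abs_lt hθ hθt hφ h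
    exact ⟨(inv_mul_le_iff₀ hC).2 (hU t θ θt φ ht.1 hcomp), hU t θt θ φ ht.1 hcomp.symm⟩
  refine ⟨C⁻¹, C, inv_pos.2 hC, hC, key, fun t θ φ φt ht hθ hφ hφt h => ?_⟩
  rw [Ups_comm α β W s t θ φ, Ups_comm α β W s t θ φt]
  exact key t φ φt θ ht hφ hφt hθ (by rwa [abs_sub_comm φ θ])
end
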